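/- arXiv:2306.02158 — 3 statements merged into one kernel-verified Lean document; each statement's English description precedes it below -/
import Mathlib

section
/- The measure ν_V^{W,θ,η} is a probability measure; that is, the integral over ℝ^V of the function β ↦ 1_{H_β is positive definite} · (2/π)^{|V|/2} · exp(−(1/2)⟨θ, H_β θ⟩ − (1/2)⟨η, H_β^{−1} η⟩ + ⟨η, θ⟩) · (∏_{i∈V} θ_i)/√(det H_β) with respect to Lebesgue measure equals 1. -/
open MeasureTheory Matrix

variable {V : Type*}

/-- `H_β = 2 diag(β) − W`. -/
noncomputable def Hmat [Fintype V] [DecidableEq V] (W : Matrix V V ℝ) (β : V → ℝ) :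
    Matrix V V ℝ :=
  Matrix.diagonal (fun i => 2 * β i) - W

/-- Density of the measure `ν_V^{W,θ,η}` with respect to Lebesgue measure on `ℝ^V`. -/
noncomputable def nuDensity [Fintype V] [DecidableEq V] (W : Matrix V V ℝ) (θ η : V → ℝ)
    (β : V → ℝ) : ℝ :=
  Set.indicator {β : V → ℝ | (Hmat W β).PosDef}
    (fun β =>
      (2 / Real.pi) ^ ((Fintype.card V : ℝ) / 2) *
        Real.exp (-(1 / 2) * (θ ⬝ᵥ Hmat W β *ᵥ θ)
          - (1 / 2) * (η ⬝ᵥ (Hmat W β)⁻¹ *ᵥ η) + η ⬝ᵥ θ) *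
        (∏ i, θ i) / Real.sqrt (Hmat W β).det) β

set_option linter.unusedSectionVars false
set_option linter.style.haveILetI false

def blk {U : Type*} (a : ℝ) (w : U → ℝ) (D : Matrix U U ℝ) : Matrix (Unit ⊕ U) (Unit ⊕ U) ℝ :=
  Matrix.fromBlocks (Matrix.of fun _ _ => a) (Matrix.of fun _ j => - w j)
    (Matrix.of fun i _ => - w i) D

section blk
variable {U : Type*} [Fintype U] [DecidableEq U] (a : ℝ) (w : U → ℝ) (D : Matrix U U ℝ)

lemma blk_mulVec (x0 : ℝ) (x : U → ℝ) :
    blk a w D *ᵥ Sum.elim (fun _ => x0) x =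
      Sum.elim (fun _ => a * x0 - w ⬝ᵥ x) (D *ᵥ x - x0 • w) := by
  rw [blk, Matrix.fromBlocks_mulVec]
  ext (i | i)
  · simp [mulVec, dotProduct, sub_eq_add_neg]
  · simp [mulVec, dotProduct, sub_eq_add_neg]; ring

lemma blk_quad (x0 : ℝ) (x : U → ℝ) :
    Sum.elim (fun _ => x0) x ⬝ᵥ (blk a w D *ᵥ Sum.elim (fun _ => x0) x) =
      a * x0 ^ 2 - 2 * x0 * (w ⬝ᵥ x) + x ⬝ᵥ (D *ᵥ x) := by
  rw [blk_mulVec, sumElim_dotProduct_sumElim, dotProduct_sub, dotProduct_smul,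
    dotProduct_comm x w]
  simp [dotProduct]; ring

lemma D_inv_mul (hD : D.PosDef) (x : U → ℝ) : D *ᵥ (D⁻¹ *ᵥ x) = x := by
  rw [mulVec_mulVec, Matrix.mul_nonsing_inv _ ((Matrix.isUnit_iff_isUnit_det _).1 hD.isUnit),
    one_mulVec]

lemma D_symm (hD : D.IsHermitian) (x y : U → ℝ) : x ⬝ᵥ D *ᵥ y = y ⬝ᵥ D *ᵥ x := by
  have h : Dᵀ = D := by simpa [Matrix.IsHermitian] using hD
  rw [dotProduct_mulVec, ← mulVec_transpose, h, dotProduct_comm]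

lemma blk_quad' (hD : D.PosDef) (x0 : ℝ) (x : U → ℝ) :
    Sum.elim (fun _ => x0) x ⬝ᵥ (blk a w D *ᵥ Sum.elim (fun _ => x0) x) =
      (a - w ⬝ᵥ D⁻¹ *ᵥ w) * x0 ^ 2 +
        (x - x0 • (D⁻¹ *ᵥ w)) ⬝ᵥ (D *ᵥ (x - x0 • (D⁻¹ *ᵥ w))) := by
  rw [blk_quad, mulVec_sub, mulVec_smul, D_inv_mul D hD]
  simp only [sub_dotProduct, dotProduct_sub, smul_dotProduct, dotProduct_smul, smul_eq_mul]
  rw [D_symm D hD.1 (D⁻¹ *ᵥ w) x, D_inv_mul D hD, dotProduct_comm x w,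
    dotProduct_comm (D⁻¹ *ᵥ w) w]
  ring

lemma blk_posDef (hD : D.PosDef) : (blk a w D).PosDef ↔ 0 < a - w ⬝ᵥ D⁻¹ *ᵥ w := by
  constructor
  · intro h
    have := h.dotProduct_mulVec_pos (x := Sum.elim (fun _ => (1:ℝ)) (D⁻¹ *ᵥ w)) (by
      intro h0; have := congrFun h0 (Sum.inl ()); simp at this)
    rw [star_trivial, blk_quad' _ _ _ hD] at this
    simpa using this
  · intro hs
    refine Matrix.PosDef.of_dotProduct_mulVec_pos ?_ ?_
    · have h : Dᵀ = D := by simpa [Matrix.IsHermitian] using hD.1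
      rw [Matrix.IsHermitian, conjTranspose_eq_transpose_of_trivial, blk, fromBlocks_transpose, h]
      rfl
    · intro x hx
      obtain ⟨x0, y, rfl⟩ : ∃ x0 y, x = Sum.elim (fun _ => x0) y :=
        ⟨x (Sum.inl ()), fun i => x (Sum.inr i), by ext (i | i) <;> rfl⟩
      rw [star_trivial, blk_quad' _ _ _ hD]
      by_cases h0 : x0 = 0
      · subst h0
        have hy : y ≠ 0 := by
          rintro rfl; apply hx; ext (i | i) <;> rfl
        have := hD.dotProduct_mulVec_pos hy
        simpa using this
      · have h1 := hD.posSemidef.dotProduct_mulVec_nonneg (y - x0 • (D⁻¹ *ᵥ w) : U → ℝ)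
        rw [star_trivial] at h1
        have : 0 < x0 ^ 2 := by positivity
        have := mul_pos hs this
        linarith
  
lemma blk_posDef_right (h : (blk a w D).PosDef) : D.PosDef := by
  have := h.submatrix (e := (Sum.inr : U → Unit ⊕ U)) Sum.inr_injective
  exact this

lemma blk_det (hD : D.PosDef) : (blk a w D).det = D.det * (a - w ⬝ᵥ D⁻¹ *ᵥ w) := by
  letI := hD.isUnit.invertible
  rw [blk, det_fromBlocks₂₂]
  congr 1
  rw [det_unique, invOf_eq_nonsing_inv, Matrix.mul_assoc]
  simp [Matrix.mul_apply, mulVec, dotProduct]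

lemma blk_inv (hD : D.PosDef) (hs : 0 < a - w ⬝ᵥ D⁻¹ *ᵥ w) (x0 : ℝ) (x : U → ℝ) :
    Sum.elim (fun _ => x0) x ⬝ᵥ ((blk a w D)⁻¹ *ᵥ Sum.elim (fun _ => x0) x) =
      (x0 + w ⬝ᵥ D⁻¹ *ᵥ x) ^ 2 / (a - w ⬝ᵥ D⁻¹ *ᵥ w) + x ⬝ᵥ D⁻¹ *ᵥ x := by
  have hP := (blk_posDef a w D hD).2 hs
  set s := a - w ⬝ᵥ D⁻¹ *ᵥ w with hsdef
  set c := x0 + w ⬝ᵥ D⁻¹ *ᵥ x with hc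
  have key : blk a w D *ᵥ Sum.elim (fun _ => c / s) (D⁻¹ *ᵥ x + (c / s) • (D⁻¹ *ᵥ w)) =
      Sum.elim (fun _ => x0) x := by
    rw [blk_mulVec, mulVec_add, mulVec_smul, D_inv_mul D hD, D_inv_mul D hD]
    have : a * (c / s) - w ⬝ᵥ (D⁻¹ *ᵥ x + (c / s) • (D⁻¹ *ᵥ w)) = x0 := by
      rw [dotProduct_add, dotProduct_smul, smul_eq_mul]
      have : a = s + w ⬝ᵥ D⁻¹ *ᵥ w := by rw [hsdef]; ring
      have h2 : s * (c / s) = c := by field_simp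
      rw [this]; linear_combination h2 + hc
    rw [this]; simp
  have hinv : (blk a w D)⁻¹ *ᵥ Sum.elim (fun _ => x0) x =
      Sum.elim (fun _ => c / s) (D⁻¹ *ᵥ x + (c / s) • (D⁻¹ *ᵥ w)) := by
    rw [← key, mulVec_mulVec,
      Matrix.nonsing_inv_mul _ ((Matrix.isUnit_iff_isUnit_det _).1 hP.isUnit), one_mulVec]
  rw [hinv, sumElim_dotProduct_sumElim, dotProduct_add, dotProduct_smul,
    D_symm D⁻¹ hD.inv.1 x w]
  simp
  rw [sq, mul_div_assoc, hc]; ring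
end blk

lemma inv_nonneg_aux {U : Type*} [Fintype U] [DecidableEq U] (D : Matrix U U ℝ) (hD : D.PosDef)
    (hoff : ∀ i j, i ≠ j → D i j ≤ 0) (y : U → ℝ) (hy : ∀ i, 0 ≤ y i) :
    ∀ i, 0 ≤ (D⁻¹ *ᵥ y) i := by
  set x := D⁻¹ *ᵥ y with hx
  have hDx : D *ᵥ x = y := D_inv_mul D hD y
  set p : U → ℝ := fun i => max (x i) 0
  set m : U → ℝ := fun i => max (- x i) 0
  have hxpm : x = p - m := by
    ext i; simp only [p, m, Pi.sub_apply]
    rcases le_total (x i) 0 with h | h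
    · rw [max_eq_right h, max_eq_left (by linarith)]; ring
    · rw [max_eq_left h, max_eq_right (by linarith)]; ring
  have h1 : 0 ≤ m ⬝ᵥ D *ᵥ x := by
    rw [hDx]; exact Finset.sum_nonneg fun i _ => mul_nonneg (le_max_right _ _) (hy i)
  have h2 : m ⬝ᵥ D *ᵥ p ≤ 0 := by
    simp only [dotProduct, mulVec, Finset.mul_sum]
    refine Finset.sum_nonpos fun i _ => Finset.sum_nonpos fun j _ => ?_
    by_cases hij : i = j
    · subst hij
      have : m i * p i = 0 := by
        simp only [p, m]
        rcases le_total (x i) 0 with h | h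
        · rw [max_eq_right h]; ring
        · rw [max_eq_right (show -x i ≤ 0 by linarith)]; ring
      apply le_of_eq; linear_combination D i i * this
    · exact mul_nonpos_of_nonneg_of_nonpos (le_max_right _ _)
        (mul_nonpos_of_nonpos_of_nonneg (hoff i j hij) (le_max_right _ _))
  rw [hxpm, mulVec_sub, dotProduct_sub] at h1
  have hm : m = 0 := by
    by_contra hne
    have := hD.dotProduct_mulVec_pos hne
    rw [star_trivial] at this
    linarith
  intro i
  have := congrFun hm i
  simp only [m, Pi.zero_apply] at this
  have := le_max_left (-x i) 0
  linarith

open Set in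
lemma gauss_aux (a c : ℝ) (ha : 0 < a) (hc : 0 ≤ c) :
    ∫⁻ t in Ioi (0:ℝ), ENNReal.ofReal (Real.exp (-(1/2) * (a * t - c / t) ^ 2)) =
      ENNReal.ofReal (Real.sqrt (2 * Real.pi) / (2 * a)) := by
  rcases hc.eq_or_lt with rfl | hc
  · rw [← ofReal_integral_eq_lintegral_ofReal]
    · congr 1
      have := integral_gaussian_Ioi (a ^ 2 / 2)
      have h2 : ∀ t : ℝ, -(1/2) * (a * t - 0 / t) ^ 2 = -(a^2/2) * t ^ 2 := by intro t; simp; ring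
      simp_rw [h2]
      rw [this]
      have : Real.pi / (a^2/2) = (2 * Real.pi) / a ^ 2 := by field_simp
      rw [this, Real.sqrt_div (by positivity), Real.sqrt_sq ha.le]
      field_simp
    · have h2 : ∀ t : ℝ, -(1/2) * (a * t - 0 / t) ^ 2 = -(a^2/2) * t ^ 2 := by intro t; simp; ring
      simp_rw [h2]
      exact (integrable_exp_neg_mul_sq (by positivity)).integrableOn
    · filter_upwards with t using (Real.exp_pos _).le
  · set g : ℝ → ENNReal := fun u => ENNReal.ofReal (Real.exp (-(1/2) * u ^ 2)) with hg
    have hgm : Measurable g := by fun_prop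
    set φ : ℝ → ℝ := fun t => a * t - c / t with hφ
    have hφm : Measurable φ := by fun_prop
    -- total
    have hd : ∀ t ∈ Ioi (0:ℝ), HasDerivWithinAt φ (a + c / t ^ 2) (Ioi 0) t := by
      intro t ht
      have ht' : t ≠ 0 := (mem_Ioi.1 ht).ne'
      have h1 : HasDerivAt φ (a * 1 - c * (-(t ^ 2)⁻¹)) t := by
        have := ((hasDerivAt_id t).const_mul a).sub ((hasDerivAt_inv ht').const_mul c)
        exact this
      refine (h1.congr_deriv ?_).hasDerivWithinAt
      rw [div_eq_mul_inv]; ring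
    have hinj : InjOn φ (Ioi 0) := by
      intro s hs t ht h
      have hs : 0 < s := hs
      have ht : 0 < t := ht
      simp only [hφ] at h
      field_simp at h
      have h3 : (s - t) * (a * s * t + c) = 0 := by linear_combination h
      rcases mul_eq_zero.1 h3 with h | h
      · linarith
      · have : 0 < a * s * t + c := by positivity
        linarith
    have himg : φ '' Ioi 0 = univ := by
      apply eq_univ_of_forall
      intro u
      have hlt : |u| < Real.sqrt (u ^ 2 + 4 * a * c) := by
        rw [← Real.sqrt_sq_eq_abs]
        exact Real.sqrt_lt_sqrt (sq_nonneg _) (by nlinarith [mul_pos ha hc])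
      have hpos : 0 < u + Real.sqrt (u ^ 2 + 4 * a * c) := by
        have := neg_abs_le u; linarith
      have hsq : Real.sqrt (u ^ 2 + 4 * a * c) ^ 2 = u ^ 2 + 4 * a * c :=
        Real.sq_sqrt (by positivity)
      refine ⟨(u + Real.sqrt (u ^ 2 + 4 * a * c)) / (2 * a), ?_, ?_⟩
      · exact div_pos hpos (by positivity)
      · simp only [hφ]
        set r := Real.sqrt (u ^ 2 + 4 * a * c)
        field_simp
        linear_combination hsq
    have tot := lintegral_image_eq_lintegral_abs_deriv_mul measurableSet_Ioi hd hinj g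
    rw [himg, Measure.restrict_univ] at tot
    have htot : ∫⁻ u, g u = ENNReal.ofReal (Real.sqrt (2 * Real.pi)) := by
      rw [hg, ← ofReal_integral_eq_lintegral_ofReal]
      · rw [integral_gaussian]; congr 2; ring
      · exact integrable_exp_neg_mul_sq (by norm_num)
      · filter_upwards with t using (Real.exp_pos _).le
    -- symmetry
    set ψ : ℝ → ℝ := fun t => (c / a) / t with hψ
    have hd2 : ∀ t ∈ Ioi (0:ℝ), HasDerivWithinAt ψ (- (c / a / t ^ 2)) (Ioi 0) t := by
      intro t ht
      have ht' : t ≠ 0 := (mem_Ioi.1 ht).ne'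
      have h1 : HasDerivAt ψ ((c / a) * (-(t ^ 2)⁻¹)) t :=
        (hasDerivAt_inv ht').const_mul (c / a)
      refine (h1.congr_deriv ?_).hasDerivWithinAt
      rw [div_eq_mul_inv (c / a)]; ring
    have hinj2 : InjOn ψ (Ioi 0) := by
      intro s hs t ht h
      have hs : 0 < s := hs
      have ht : 0 < t := ht
      simp only [hψ] at h
      field_simp at h
      linarith
    have himg2 : ψ '' Ioi 0 = Ioi 0 := by
      ext u
      constructor
      · rintro ⟨t, ht, rfl⟩
        have ht : 0 < t := ht
        show 0 < c / a / t
        positivity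
      · intro hu
        have hu : 0 < u := hu
        refine ⟨c / a / u, ?_, ?_⟩
        · show 0 < c / a / u
          positivity
        · simp only [hψ]; field_simp
    have sym := lintegral_image_eq_lintegral_abs_deriv_mul measurableSet_Ioi hd2 hinj2
      (fun t => g (φ t))
    rw [himg2] at sym
    set I := ∫⁻ t in Ioi (0:ℝ), g (φ t) with hI
    have e2 : ENNReal.ofReal a * I =
        ∫⁻ t in Ioi (0:ℝ), ENNReal.ofReal (c / t ^ 2) * g (φ t) := by
      rw [sym, ← lintegral_const_mul' _ _ ENNReal.ofReal_ne_top]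
      refine setLIntegral_congr_fun measurableSet_Ioi fun t ht => ?_
      have ht : 0 < t := ht
      have h1 : g (φ (ψ t)) = g (φ t) := by
        simp only [hg]
        have : φ (ψ t) = - φ t := by
          simp only [hφ, hψ]; field_simp; ring
        rw [this, neg_sq]
      simp only [h1]
      rw [← mul_assoc, ← ENNReal.ofReal_mul ha.le, abs_neg, abs_of_nonneg (by positivity)]
      congr 2
      field_simp
    have e3 : ∫⁻ t in Ioi (0:ℝ), ENNReal.ofReal |a + c / t ^ 2| * g (φ t) =
        ENNReal.ofReal a * I + ENNReal.ofReal a * I := by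
      nth_rewrite 2 [e2]
      rw [hI, ← lintegral_const_mul' _ _ ENNReal.ofReal_ne_top, ← lintegral_add_left (by fun_prop)]
      refine setLIntegral_congr_fun measurableSet_Ioi fun t ht => ?_
      have ht : 0 < t := ht
      rw [abs_of_nonneg (by positivity), ENNReal.ofReal_add ha.le (by positivity), add_mul]
    rw [htot, e3] at tot
    show I = _
    have e4 : ENNReal.ofReal (2 * a) * I = ENNReal.ofReal (Real.sqrt (2 * Real.pi)) := by
      rw [tot, two_mul, ENNReal.ofReal_add ha.le ha.le, add_mul]
    rw [ENNReal.ofReal_div_of_pos (by positivity), ← e4, mul_comm, ENNReal.mul_div_cancel_right]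
    · simpa using ha
    · exact ENNReal.ofReal_ne_top

open Set in
/-- the inner integral -/
lemma inner_aux (a c k : ℝ) (ha : 0 < a) (hc : 0 ≤ c) :
    ∫⁻ b in {b : ℝ | 0 < 2 * b - k}, ENNReal.ofReal
      (Real.exp (-(1/2) * (a ^ 2 * (2 * b - k)) - (1/2) * (c ^ 2 / (2 * b - k))) /
        Real.sqrt (2 * b - k)) =
      ENNReal.ofReal (Real.sqrt (2 * Real.pi) / (2 * a) * Real.exp (- (a * c))) := by
  have hinj : InjOn (fun t : ℝ => (t ^ 2 + k) / 2) (Ioi 0) := by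
    intro s hs t ht h
    have hs : 0 < s := hs
    have ht : 0 < t := ht
    have : s ^ 2 = t ^ 2 := by simp only at h; linarith
    exact (pow_left_inj₀ hs.le ht.le (by norm_num)).1 this
  have hd : ∀ t ∈ Ioi (0:ℝ), HasDerivWithinAt (fun t : ℝ => (t ^ 2 + k) / 2) t (Ioi 0) t := by
    intro t ht
    have := ((hasDerivAt_pow 2 t).add_const k).div_const 2
    refine (this.congr_deriv ?_).hasDerivWithinAt
    simp
  have himg : (fun t : ℝ => (t ^ 2 + k) / 2) '' Ioi 0 = {b : ℝ | 0 < 2 * b - k} := by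
    ext b
    constructor
    · rintro ⟨t, ht, rfl⟩
      have ht : 0 < t := ht
      show 0 < 2 * ((t ^ 2 + k) / 2) - k
      have : 0 < t ^ 2 := by positivity
      linarith
    · intro hb
      have hb : 0 < 2 * b - k := hb
      refine ⟨Real.sqrt (2 * b - k), Real.sqrt_pos.2 hb, ?_⟩
      simp only [Real.sq_sqrt hb.le]; ring
  have := lintegral_image_eq_lintegral_abs_deriv_mul measurableSet_Ioi hd hinj
    (fun b => ENNReal.ofReal
      (Real.exp (-(1/2) * (a ^ 2 * (2 * b - k)) - (1/2) * (c ^ 2 / (2 * b - k))) /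
        Real.sqrt (2 * b - k)))
  rw [himg] at this
  rw [this, ENNReal.ofReal_mul (by positivity), ← gauss_aux a c ha hc,
    ← lintegral_mul_const' _ _ ENNReal.ofReal_ne_top]
  refine setLIntegral_congr_fun measurableSet_Ioi fun t ht => ?_
  have ht : 0 < t := ht
  have h1 : 2 * ((t ^ 2 + k) / 2) - k = t ^ 2 := by ring
  simp only [h1]
  rw [← ENNReal.ofReal_mul (abs_nonneg _), ← ENNReal.ofReal_mul (Real.exp_pos _).le,
    ← Real.exp_add, Real.sqrt_sq ht.le, abs_of_pos ht, mul_div_cancel₀ _ ht.ne']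
  congr 2
  field_simp
  ring

section main
variable {U : Type*} [Fintype U] [DecidableEq U]

lemma Hmat_cont (W : Matrix U U ℝ) : Continuous (fun β : U → ℝ => Hmat W β) := by
  unfold Hmat
  refine Continuous.sub (Continuous.matrix_diagonal ?_) continuous_const
  fun_prop

lemma nu_aemeas (W : Matrix U U ℝ) (θ η : U → ℝ) :
    AEMeasurable (fun β : U → ℝ => nuDensity W θ η β) volume := by
  have hc : Convex ℝ {β : U → ℝ | (Hmat W β).PosDef} := by
    rw [convex_iff_forall_pos]
    intro x hx y hy a b ha hb hab
    have : Hmat W (a • x + b • y) = a • Hmat W x + b • Hmat W y := by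
      ext i j
      have hW : W i j = a * W i j + b * W i j := by rw [← add_mul, hab, one_mul]
      simp only [Hmat, Matrix.sub_apply, Matrix.add_apply, Matrix.smul_apply, diagonal_apply, Pi.add_apply,
        Pi.smul_apply, smul_eq_mul]
      split_ifs <;> linear_combination -hW
    show (Hmat W _).PosDef
    rw [this]
    exact (Matrix.PosDef.smul hx ha).add (Matrix.PosDef.smul hy hb)
  have hns := hc.nullMeasurableSet (volume : Measure (U → ℝ))
  unfold nuDensity
  refine AEMeasurable.indicator₀ (Measurable.aemeasurable ?_) hns
  have h := Hmat_cont W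
  have hdet : Measurable (fun β : U → ℝ => (Hmat W β).det) := (h.matrix_det).measurable
  have hq : Measurable (fun β : U → ℝ => θ ⬝ᵥ Hmat W β *ᵥ θ) := by
    have : Continuous (fun β : U → ℝ => θ ⬝ᵥ Hmat W β *ᵥ θ) :=
      continuous_const.dotProduct (h.matrix_mulVec continuous_const)
    exact this.measurable
  have hi : Measurable (fun β : U → ℝ => η ⬝ᵥ (Hmat W β)⁻¹ *ᵥ η) := by
    have h2 : Continuous (fun β : U → ℝ => η ⬝ᵥ (Hmat W β).adjugate *ᵥ η) :=
      continuous_const.dotProduct (h.matrix_adjugate.matrix_mulVec continuous_const)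
    have : (fun β : U → ℝ => η ⬝ᵥ (Hmat W β)⁻¹ *ᵥ η) =
        fun β => ((Hmat W β).det)⁻¹ * (η ⬝ᵥ (Hmat W β).adjugate *ᵥ η) := by
      ext β
      rw [Matrix.inv_def, smul_mulVec, dotProduct_smul, Ring.inverse_eq_inv', smul_eq_mul]
    rw [this]
    exact hdet.inv.mul h2.measurable
  fun_prop

def PP (U : Type*) [Fintype U] [DecidableEq U] : Prop :=
  ∀ (W : Matrix U U ℝ) (_ : W.IsSymm) (_ : ∀ i j, 0 ≤ W i j)
    (θ η : U → ℝ) (_ : ∀ i, 0 < θ i) (_ : ∀ i, 0 ≤ η i),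
    ∫⁻ β : U → ℝ, ENNReal.ofReal (nuDensity W θ η β) = 1

lemma nu_reindex {V' : Type*} [Fintype V'] [DecidableEq V'] (e : V' ≃ U) (W : Matrix U U ℝ)
    (θ η β : U → ℝ) :
    nuDensity W θ η β = nuDensity (W.submatrix e e) (θ ∘ e) (η ∘ e) (β ∘ e) := by
  have hH : Hmat (W.submatrix e e) (β ∘ e) = (Hmat W β).submatrix e e := by
    ext i j
    simp [Hmat, diagonal_apply]
  have hp : (Hmat (W.submatrix e e) (β ∘ e)).PosDef ↔ (Hmat W β).PosDef := by
    rw [hH]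
    constructor
    · intro h
      have := h.submatrix (e := e.symm) e.symm.injective
      simpa using this
    · intro h
      exact h.submatrix e.injective
  have hd : ∀ x y : U → ℝ, (x ∘ e) ⬝ᵥ (y ∘ e) = x ⬝ᵥ y := fun x y =>
    Equiv.sum_comp e (fun i => x i * y i)
  have hm : ∀ (M : Matrix U U ℝ) (x : U → ℝ), M.submatrix e e *ᵥ (x ∘ e) = (M *ᵥ x) ∘ e := by
    intro M x
    ext i
    exact Equiv.sum_comp e (fun j => M (e i) j * x j)
  unfold nuDensity
  by_cases h : (Hmat W β).PosDef
  · rw [Set.indicator_of_mem (show β ∈ {β : U → ℝ | (Hmat W β).PosDef} from h),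
      Set.indicator_of_mem
        (show β ∘ e ∈ {β : V' → ℝ | (Hmat (W.submatrix e e) β).PosDef} from hp.2 h)]
    rw [hH, inv_submatrix_equiv, hm, hm, hd, hd, hd, det_submatrix_equiv_self,
      Fintype.card_congr e]
    congr 2
    exact (Equiv.prod_comp e θ).symm
  · rw [Set.indicator_of_notMem (show β ∉ {β : U → ℝ | (Hmat W β).PosDef} from h),
      Set.indicator_of_notMem
        (show β ∘ e ∉ {β : V' → ℝ | (Hmat (W.submatrix e e) β).PosDef} from fun h' => h (hp.1 h'))]

lemma PP_congr {V' : Type*} [Fintype V'] [DecidableEq V'] (e : V' ≃ U) (h : PP V') : PP U := by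
  intro W hW hp θ η hθ hη
  have := h (W.submatrix e e) (hW.submatrix e) (fun i j => hp _ _) (θ ∘ e) (η ∘ e)
    (fun i => hθ _) (fun i => hη _)
  rw [← this]
  have hmp := (volume_measurePreserving_piCongrLeft (fun _ : U => ℝ) e)
  rw [← hmp.lintegral_comp_emb (MeasurableEquiv.measurableEmbedding _)]
  refine lintegral_congr fun β => ?_
  rw [nu_reindex e]
  congr 3
  ext i
  simp [MeasurableEquiv.piCongrLeft]

lemma Hmat_blk (W : Matrix (Unit ⊕ U) (Unit ⊕ U) ℝ) (hW : W.IsSymm) (b : ℝ) (β : U → ℝ) :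
    Hmat W (Sum.elim (fun _ => b) β) =
      blk (2 * b - W (Sum.inl ()) (Sum.inl ())) (fun j => W (Sum.inl ()) (Sum.inr j))
        (Hmat W.toBlocks₂₂ β) := by
  ext (i | i) (j | j)
  · simp [Hmat, blk]
  · simp [Hmat, blk]
  · simp only [Hmat, blk, Matrix.sub_apply, fromBlocks_apply₂₁, of_apply]
    rw [diagonal_apply_ne _ (by simp), hW.apply]; simp
  · simp [Hmat, blk, diagonal_apply, toBlocks₂₂]

lemma inner_step (W : Matrix (Unit ⊕ U) (Unit ⊕ U) ℝ) (hW : W.IsSymm) (hp : ∀ i j, 0 ≤ W i j)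
    (t0 e0 : ℝ) (θ η : U → ℝ) (ht0 : 0 < t0) (he0 : 0 ≤ e0) (hη : ∀ i, 0 ≤ η i) (β : U → ℝ) :
    ∫⁻ b : ℝ, ENNReal.ofReal (nuDensity W (Sum.elim (fun _ => t0) θ) (Sum.elim (fun _ => e0) η)
      (Sum.elim (fun _ => b) β)) =
    ENNReal.ofReal (nuDensity W.toBlocks₂₂ θ
      (η + t0 • (fun j => W (Sum.inl ()) (Sum.inr j))) β) := by
  by_cases hD : (Hmat W.toBlocks₂₂ β).PosDef
  swap
  · have h1 : ∀ b : ℝ, nuDensity W (Sum.elim (fun _ => t0) θ) (Sum.elim (fun _ => e0) η)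
      (Sum.elim (fun _ => b) β) = 0 := by
      intro b
      unfold nuDensity
      apply Set.indicator_of_notMem
      intro h
      apply hD
      have h : (Hmat W (Sum.elim (fun _ => b) β)).PosDef := h
      rw [Hmat_blk W hW] at h
      exact blk_posDef_right _ _ _ h
    have h2 : nuDensity W.toBlocks₂₂ θ
      (η + t0 • (fun j => W (Sum.inl ()) (Sum.inr j))) β = 0 := by
      unfold nuDensity
      exact Set.indicator_of_notMem
        (show β ∉ {β : U → ℝ | (Hmat W.toBlocks₂₂ β).PosDef} from hD) _
    simp [h1, h2]
  set w : U → ℝ := fun j => W (Sum.inl ()) (Sum.inr j) with hw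
  set D := Hmat W.toBlocks₂₂ β with hDdef
  set k := W (Sum.inl ()) (Sum.inl ()) + w ⬝ᵥ D⁻¹ *ᵥ w with hk
  set c := e0 + w ⬝ᵥ D⁻¹ *ᵥ η with hc
  have hoff : ∀ i j, i ≠ j → D i j ≤ 0 := by
    intro i j hij
    simp only [hDdef, Hmat, Matrix.sub_apply, diagonal_apply_ne _ hij, toBlocks₂₂, of_apply]
    have := hp (Sum.inr i) (Sum.inr j)
    linarith
  have hc0 : 0 ≤ c := by
    have := inv_nonneg_aux D hD hoff η hη
    exact add_nonneg he0 (Finset.sum_nonneg fun i _ => mul_nonneg (hp _ _) (this i))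
  set E1 : ℝ := -(1/2) * (θ ⬝ᵥ D *ᵥ θ) + t0 * (w ⬝ᵥ θ) - (1/2) * t0 ^ 2 * (w ⬝ᵥ D⁻¹ *ᵥ w)
    - (1/2) * (η ⬝ᵥ D⁻¹ *ᵥ η) + e0 * t0 + η ⬝ᵥ θ with hE1
  set C : ℝ := (2 / Real.pi) ^ (((Fintype.card U + 1 : ℕ) : ℝ) / 2) * Real.exp E1 *
    (t0 * ∏ i, θ i) / Real.sqrt D.det with hC
  have hdet : 0 < D.det := hD.det_pos
  have hden : ∀ b : ℝ, ENNReal.ofReal (nuDensity W (Sum.elim (fun _ => t0) θ)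
      (Sum.elim (fun _ => e0) η) (Sum.elim (fun _ => b) β)) =
      Set.indicator {b : ℝ | 0 < 2 * b - k} (fun b => ENNReal.ofReal
      (Real.exp (-(1/2) * (t0 ^ 2 * (2 * b - k)) - (1/2) * (c ^ 2 / (2 * b - k))) /
        Real.sqrt (2 * b - k)) * ENNReal.ofReal C) b := by
    intro b
    have hs : 2 * b - W (Sum.inl ()) (Sum.inl ()) - w ⬝ᵥ D⁻¹ *ᵥ w = 2 * b - k := by
      rw [hk]; ring
    have hiff := blk_posDef (2 * b - W (Sum.inl ()) (Sum.inl ())) w D hD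
    rw [hs] at hiff
    unfold nuDensity
    by_cases hb : 0 < 2 * b - k
    · have hP := hiff.2 hb
      rw [← Hmat_blk W hW] at hP
      rw [Set.indicator_of_mem (show _ ∈ {β : Unit ⊕ U → ℝ | (Hmat W β).PosDef} from hP),
        Set.indicator_of_mem (show b ∈ {b : ℝ | 0 < 2 * b - k} from hb),
        ← ENNReal.ofReal_mul (by positivity), Hmat_blk W hW, ← hw, ← hDdef, blk_quad,
        blk_inv _ _ _ hD (by rw [hs]; exact hb), blk_det _ _ _ hD, hs,
        sumElim_dotProduct_sumElim, Real.sqrt_mul hdet.le]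
      congr 1
      rw [hC, Fintype.prod_sum_type]
      have hcard : (Fintype.card (Unit ⊕ U)) = Fintype.card U + 1 := by
        simp [add_comm]
      rw [hcard]
      have hexp : ∀ x : ℝ, x = (-(1/2) * (t0 ^ 2 * (2 * b - k)) -
          (1/2) * (c ^ 2 / (2 * b - k))) + E1 → Real.exp x =
          Real.exp (-(1/2) * (t0 ^ 2 * (2 * b - k)) - (1/2) * (c ^ 2 / (2 * b - k))) *
          Real.exp E1 := by
        rintro x rfl; exact Real.exp_add _ _
      rw [hexp]
      · simp only [Sum.elim_inl, Sum.elim_inr, Finset.univ_unique, Finset.prod_singleton]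
        have h1 := Real.sqrt_pos.2 hb
        have h2 := Real.sqrt_pos.2 hdet
        field_simp
      · rw [hE1, ← hc, hk]
        simp only [dotProduct, Finset.univ_unique, Finset.sum_singleton]
        ring
    · have hP : ¬ (Hmat W (Sum.elim (fun _ => b) β)).PosDef := by
        rw [Hmat_blk W hW]; exact fun h => hb (hiff.1 h)
      rw [Set.indicator_of_notMem (show _ ∉ {β : Unit ⊕ U → ℝ | (Hmat W β).PosDef} from hP),
        Set.indicator_of_notMem (show b ∉ {b : ℝ | 0 < 2 * b - k} from hb)]
      simp
  simp_rw [hden]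
  rw [lintegral_indicator (measurableSet_lt (by fun_prop) (by fun_prop)),
    lintegral_mul_const' _ _ ENNReal.ofReal_ne_top, inner_aux t0 c k ht0 hc0,
    ← ENNReal.ofReal_mul (by positivity)]
  congr 1
  unfold nuDensity
  rw [Set.indicator_of_mem (show β ∈ {β : U → ℝ | (Hmat W.toBlocks₂₂ β).PosDef} from hD),
    ← hDdef, hC]
  have hpow : (2 / Real.pi) ^ (((Fintype.card U + 1 : ℕ) : ℝ) / 2) =
      (2 / Real.pi) ^ ((Fintype.card U : ℝ) / 2) * (2 / Real.sqrt (2 * Real.pi)) := by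
    have hpi := Real.pi_pos
    push_cast
    rw [add_div, Real.rpow_add (by positivity), ← Real.sqrt_eq_rpow]
    congr 1
    rw [Real.sqrt_div (by norm_num), Real.sqrt_mul (by norm_num),
      div_eq_div_iff (by positivity) (by positivity)]
    have := Real.mul_self_sqrt (show (0:ℝ) ≤ 2 by norm_num)
    linear_combination Real.sqrt Real.pi * this
  rw [hpow]
  have hexp : Real.exp (-(1 / 2) * (θ ⬝ᵥ D *ᵥ θ) -
      (1 / 2) * ((η + t0 • w) ⬝ᵥ D⁻¹ *ᵥ (η + t0 • w)) + (η + t0 • w) ⬝ᵥ θ) =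
      Real.exp (-(t0 * c)) * Real.exp E1 := by
    rw [← Real.exp_add]
    congr 1
    simp only [mulVec_add, mulVec_smul, add_dotProduct, dotProduct_add, smul_dotProduct,
      dotProduct_smul, smul_eq_mul]
    rw [D_symm D⁻¹ hD.inv.1 η w, hc, hE1]
    ring
  rw [hexp]
  have h1 : 0 < Real.sqrt (2 * Real.pi) := Real.sqrt_pos.2 (by positivity)
  have h2 := Real.sqrt_pos.2 hdet
  field_simp

lemma PP_step (h : PP U) : PP (Unit ⊕ U) := by
  intro W hW hp θ η hθ hη
  have hmp := (volume_measurePreserving_sumPiEquivProdPi_symm (fun _ : Unit ⊕ U => ℝ))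
  have hmp2 := (volume_preserving_funUnique Unit ℝ).symm
  have hmp3 : MeasurePreserving (fun p : ℝ × (U → ℝ) =>
      (MeasurableEquiv.sumPiEquivProdPi (fun _ : Unit ⊕ U => ℝ)).symm
        ((MeasurableEquiv.funUnique Unit ℝ).symm p.1, p.2)) (volume.prod volume) volume :=
    hmp.comp (hmp2.prod (MeasurePreserving.id volume))
  have hf : (fun p : ℝ × (U → ℝ) =>
      (MeasurableEquiv.sumPiEquivProdPi (fun _ : Unit ⊕ U => ℝ)).symm
        ((MeasurableEquiv.funUnique Unit ℝ).symm p.1, p.2)) =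
      fun p => Sum.elim (fun _ => p.1) p.2 := by
    ext p (i | i) <;> rfl
  rw [hf] at hmp3
  have ham := (nu_aemeas W θ η).ennreal_ofReal
  rw [← hmp3.map_eq] at ham ⊢
  have ham2 := ham.comp_aemeasurable hmp3.aemeasurable
  rw [Function.comp_def] at ham2
  rw [lintegral_map' ham hmp3.aemeasurable, lintegral_prod_symm _ ham2]
  have hθ' : θ = Sum.elim (fun _ => θ (Sum.inl ())) (fun i => θ (Sum.inr i)) := by
    ext (i | i) <;> rfl
  have hη' : η = Sum.elim (fun _ => η (Sum.inl ())) (fun i => η (Sum.inr i)) := by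
    ext (i | i) <;> rfl
  rw [hθ', hη']
  simp_rw [inner_step W hW hp (θ (Sum.inl ())) (η (Sum.inl ())) (fun i => θ (Sum.inr i))
    (fun i => η (Sum.inr i)) (hθ _) (hη _) (fun i => hη _)]
  refine h _ ?_ (fun i j => hp _ _) _ _ (fun i => hθ _) (fun i => ?_)
  · ext i j; exact hW.apply _ _
  · exact add_nonneg (hη _) (mul_nonneg (hθ _).le (hp _ _))
end main

lemma PP_fin (n : ℕ) : PP (Fin n) := by
  induction n with
  | zero =>
    intro W _ _ θ η _ _
    have : ∀ β, nuDensity W θ η β = 1 := by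
      intro β
      unfold nuDensity
      rw [Set.indicator_of_mem]
      · simp
      · refine Matrix.PosDef.of_dotProduct_mulVec_pos (by ext i; exact i.elim0) ?_
        intro x hx
        exact absurd (Subsingleton.elim _ _) hx
    simp [this, volume_pi]
  | succ n ih =>
    exact PP_congr (Fintype.equivOfCardEq (by simp [add_comm])) (PP_step ih)

/-- The measure `ν_V^{W,θ,η}` is a probability measure: the integral of its density
over `ℝ^V` equals `1`. -/
theorem nu_is_probability [Fintype V] [DecidableEq V] [Nonempty V]
    (W : Matrix V V ℝ) (hWsymm : W.IsSymm) (hWpos : ∀ i j, 0 ≤ W i j)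
    (θ η : V → ℝ) (hθ : ∀ i, 0 < θ i) (hη : ∀ i, 0 ≤ η i) :
    ∫ β : V → ℝ, nuDensity W θ η β = 1 := by
  have h := PP_congr (Fintype.equivFin V).symm (PP_fin _) W hWsymm hWpos θ η hθ hη
  rw [integral_eq_lintegral_of_nonneg_ae _ (nu_aemeas W θ η).aestronglyMeasurable, h]
  · simp
  · filter_upwards with β
    unfold nuDensity
    refine Set.indicator_nonneg (fun β _ => ?_) β
    have := Finset.prod_nonneg (s := Finset.univ) (fun i _ => (hθ i).le)
    positivity
end

section
/- Fix i ∈ V and set c_i = η_i + Σ_{j≠i} W_{i,j} θ_j. Then the pushforward of ν_V^{W,θ,η} under the map β ↦ 1/(2β_i − W_{i,i}) (which is well defined ν-a.e. since positive definiteness of H_β forces 2β_i − W_{i,i} > 0) is the measure on ℝ with density t ↦ 1_{t>0} · θ_i/√(2π t³) · exp(−(θ_i − c_i t)²/(2t)), i.e. the Inverse Gaussian distribution IG(θ_i/c_i, θ_i²). -/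
open MeasureTheory Matrix

variable {V : Type*}

/-- The measure `ν_V^{W,θ,η}` on `ℝ^V`. -/
noncomputable def nu [Fintype V] [DecidableEq V] (W : Matrix V V ℝ) (θ η : V → ℝ) :
    Measure (V → ℝ) :=
  volume.withDensity (fun β => ENNReal.ofReal (nuDensity W θ η β))

/-- Schur complement with respect to the entry `(i,i)`. -/
noncomputable def schurAt [Fintype V] [DecidableEq V] (A : Matrix V V ℝ) (i : V) :
    Matrix {j // j ≠ i} {j // j ≠ i} ℝ :=
  fun j k => A j k - A j i * A i k / A i i

lemma schurAt_mulVec [Fintype V] [DecidableEq V] (A : Matrix V V ℝ) (i : V)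
    (x : V → ℝ) (j : {j // j ≠ i}) :
    (schurAt A i *ᵥ (fun k : {j // j ≠ i} => x k)) j =
      ∑ k : {j // j ≠ i}, A j k * x k - A j i * (∑ k : {j // j ≠ i}, A i k * x k) / A i i := by
  simp only [schurAt, mulVec, dotProduct, sub_mul, Finset.sum_sub_distrib, Finset.mul_sum,
    Finset.sum_div]
  congr 1
  refine Finset.sum_congr rfl fun k _ => ?_
  ring

lemma quad_schurAt [Fintype V] [DecidableEq V] (A : Matrix V V ℝ) (hA : A.IsSymm) (i : V)
    (h : A i i ≠ 0) (x : V → ℝ) :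
    x ⬝ᵥ A *ᵥ x = A i i * (x i + (∑ k : {j // j ≠ i}, A i k * x k) / A i i) ^ 2 +
      (fun k : {j // j ≠ i} => x k) ⬝ᵥ schurAt A i *ᵥ (fun k : {j // j ≠ i} => x k) := by
  have e1 : ∀ j, (A *ᵥ x) j = A j i * x i + ∑ k : {j // j ≠ i}, A j k * x k := by
    intro j
    simp only [mulVec, dotProduct]
    rw [Fintype.sum_eq_add_sum_subtype_ne _ i]
  have e2 : x ⬝ᵥ A *ᵥ x = x i * (A *ᵥ x) i + ∑ k : {j // j ≠ i}, x k * (A *ᵥ x) k := by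
    simp only [dotProduct]
    rw [Fintype.sum_eq_add_sum_subtype_ne _ i]
  rw [e2]
  simp only [e1]
  simp only [dotProduct, schurAt_mulVec]
  set s := ∑ k : {j // j ≠ i}, A i k * x k with hs
  have e3 : ∑ k : {j // j ≠ i}, x k * (A k i * x i + ∑ l : {j // j ≠ i}, A k l * x l) =
      x i * s + ∑ k : {j // j ≠ i}, x k * ∑ l : {j // j ≠ i}, A k l * x l := by
    rw [hs, Finset.mul_sum, ← Finset.sum_add_distrib]
    refine Finset.sum_congr rfl fun k _ => ?_
    rw [hA.apply i k]; ring
  have e4 : ∑ k : {j // j ≠ i}, x k * (∑ l : {j // j ≠ i}, A k l * x l - A k i * s / A i i) =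
      ∑ k : {j // j ≠ i}, x k * (∑ l : {j // j ≠ i}, A k l * x l) - s * s / A i i := by
    simp only [mul_sub, Finset.sum_sub_distrib]
    congr 1
    conv_rhs => rw [hs]
    rw [Finset.sum_mul, Finset.sum_div]
    refine Finset.sum_congr rfl fun k _ => ?_
    rw [hA.apply i k]; ring
  rw [e3, e4]
  field_simp
  ring

lemma schurAt_symm [Fintype V] [DecidableEq V] (A : Matrix V V ℝ) (hA : A.IsSymm) (i : V) :
    (schurAt A i).IsSymm := by
  ext j k
  simp only [schurAt, transpose_apply]
  rw [hA.apply j k, hA.apply i k, hA.apply j i]; ring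

lemma posDef_iff_schurAt [Fintype V] [DecidableEq V] (A : Matrix V V ℝ) (hA : A.IsSymm) (i : V) :
    A.PosDef ↔ 0 < A i i ∧ (schurAt A i).PosDef := by
  constructor
  · intro hp
    have hi : 0 < A i i := hp.diag_pos
    refine ⟨hi, .of_dotProduct_mulVec_pos ?_ ?_⟩
    · exact (schurAt_symm A hA i)
    · intro y hy
      let x : V → ℝ := fun j => if h : j = i then
        -(∑ k : {j // j ≠ i}, A i k * y k) / A i i else y ⟨j, h⟩
      have hxi : x i = -(∑ k : {j // j ≠ i}, A i k * y k) / A i i := by simp [x]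
      have hxy : ∀ k : {j // j ≠ i}, x k = y k := by
        intro k; simp [x, k.2]
      have hx : x ≠ 0 := by
        intro h0
        apply hy
        ext k
        rw [← hxy k, h0]; rfl
      have := hp.dotProduct_mulVec_pos hx
      simp only [star_trivial] at this ⊢
      rw [quad_schurAt A hA i hi.ne', hxi] at this
      simp only [hxy] at this
      rw [neg_div, neg_add_cancel] at this
      simpa using this
  · rintro ⟨hi, hS⟩
    refine .of_dotProduct_mulVec_pos hA ?_
    intro x hx
    simp only [star_trivial]
    rw [quad_schurAt A hA i hi.ne']
    by_cases hy : (fun k : {j // j ≠ i} => x k) = 0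
    · have hk : ∀ k : {j // j ≠ i}, x k = 0 := fun k => congrFun hy k
      have hxi : x i ≠ 0 := by
        intro h0
        apply hx
        ext j
        by_cases hj : j = i
        · rw [hj, h0]; rfl
        · exact hk ⟨j, hj⟩
      rw [hy]
      simp only [hk]
      simp
      positivity
    · have := hS.dotProduct_mulVec_pos hy
      simp only [star_trivial] at this
      positivity

lemma det_schurAt [Fintype V] [DecidableEq V] (A : Matrix V V ℝ) (i : V) (h : A i i ≠ 0) :
    A.det = A i i * (schurAt A i).det := by
  let e : Unit ⊕ {j // j ≠ i} ≃ V :=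
    (Equiv.sumCongr (Equiv.ofUnique Unit {j // j = i}) (Equiv.refl _)).trans
      (Equiv.sumCompl (fun j => j = i))
  have hl : ∀ u, e (Sum.inl u) = i := fun u => (Equiv.ofUnique Unit {j // j = i} u).2
  have hr : ∀ u, e (Sum.inr u) = u := fun u => rfl
  rw [← Matrix.det_submatrix_equiv_self e A]
  have hb : A.submatrix e e = fromBlocks (diagonal fun _ : Unit => A i i) (of fun _ (k : {j // j ≠ i}) => A i k)
      (of fun (j : {j // j ≠ i}) _ => A j i)
      (of fun (j k : {j // j ≠ i}) => A j k) := by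
    ext a b
    rcases a with a | a <;> rcases b with b | b <;> simp [hl, hr]
  let _ : Invertible (diagonal fun _ : Unit => A i i) :=
    ⟨diagonal fun _ : Unit => (A i i)⁻¹, by ext; simp [h], by ext; simp [h]⟩
  rw [hb, det_fromBlocks₁₁]
  congr 1
  · simp
  · congr 1
    have : ⅟ (diagonal fun _ : Unit => A i i) = (diagonal fun _ : Unit => (A i i)⁻¹) := rfl
    rw [this]
    ext j k
    simp [schurAt, Matrix.mul_apply, Matrix.sub_apply]
    ring

lemma inv_quad_schurAt [Fintype V] [DecidableEq V] (A : Matrix V V ℝ) (hA : A.IsSymm) (i : V)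
    (h : A i i ≠ 0) (hS : (schurAt A i).det ≠ 0) (η : V → ℝ) :
    η ⬝ᵥ A⁻¹ *ᵥ η = η i ^ 2 / A i i +
      (fun k : {j // j ≠ i} => η k - A k i * η i / A i i) ⬝ᵥ (schurAt A i)⁻¹ *ᵥ
        (fun k : {j // j ≠ i} => η k - A k i * η i / A i i) := by
  set η' := (fun k : {j // j ≠ i} => η k - A k i * η i / A i i) with hη'
  set y := (schurAt A i)⁻¹ *ᵥ η' with hy
  have hSy : schurAt A i *ᵥ y = η' := by
    rw [hy, mulVec_mulVec, Matrix.mul_nonsing_inv _ (isUnit_iff_ne_zero.mpr hS), one_mulVec]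
  let x : V → ℝ := fun j => if h : j = i then
        (η i -(∑ k : {j // j ≠ i}, A i k * y k)) / A i i else y ⟨j, h⟩
  have hxi : x i = (η i -(∑ k : {j // j ≠ i}, A i k * y k)) / A i i := by simp [x]
  have hxy : ∀ k : {j // j ≠ i}, x k = y k := by
    intro k; simp [x, k.2]
  have hxy' : (fun k : {j // j ≠ i} => x k) = y := funext hxy
  have hAx : A *ᵥ x = η := by
    ext j
    have e1 : (A *ᵥ x) j = A j i * x i + ∑ k : {j // j ≠ i}, A j k * x k := by
      simp only [mulVec, dotProduct]
      rw [Fintype.sum_eq_add_sum_subtype_ne _ i]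
    rw [e1]
    by_cases hj : j = i
    · subst hj
      rw [hxi]
      simp only [hxy]
      field_simp
      ring
    · have := congrFun hSy ⟨j, hj⟩
      rw [← hxy', schurAt_mulVec] at this
      simp only [hη'] at this
      rw [hxi]
      simp only [hxy] at this ⊢
      field_simp at this ⊢
      linarith
  have hdet : IsUnit A.det := by
    rw [det_schurAt A i h]; exact isUnit_iff_ne_zero.mpr (mul_ne_zero h hS)
  have hinv : A⁻¹ *ᵥ η = x := by
    rw [← hAx, mulVec_mulVec, Matrix.nonsing_inv_mul _ hdet, one_mulVec]
  rw [hinv]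
  simp only [dotProduct]
  rw [Fintype.sum_eq_add_sum_subtype_ne _ i, hxi]
  simp only [hxy, hη', sub_mul, Finset.sum_sub_distrib]
  have : ∑ k : {j // j ≠ i}, A k i * η i / A i i * y k =
     η i / A i i * ∑ k : {j // j ≠ i}, A i k * y k := by
    rw [Finset.mul_sum]
    refine Finset.sum_congr rfl fun k _ => ?_
    rw [hA.apply i k]; ring
  rw [this]
  field_simp
  ring

/-- inverse Gaussian density -/
noncomputable def igDens (a c t : ℝ) : ℝ :=
  if 0 < t then a / Real.sqrt (2 * Real.pi * t ^ 3) * Real.exp (-(a - c * t) ^ 2 / (2 * t)) else 0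

lemma igDens_lintegral_eq (a c : ℝ) (ha : 0 < a) :
    ∫⁻ t, ENNReal.ofReal (igDens a c t) =
      ∫⁻ x in Set.Ioi (0:ℝ), ENNReal.ofReal
        (2 * a / Real.sqrt (2 * Real.pi) * Real.exp (-(a * x - c / x) ^ 2 / 2)) := by
  have h1 : ∫⁻ t, ENNReal.ofReal (igDens a c t) =
      ∫⁻ t in Set.Ioi (0:ℝ), ENNReal.ofReal (igDens a c t) := by
    rw [← lintegral_indicator measurableSet_Ioi]
    congr 1; ext t
    by_cases ht : 0 < t <;> simp [igDens, ht]
  have him : (fun x : ℝ => (x ^ 2)⁻¹) '' Set.Ioi 0 = Set.Ioi 0 := by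
    ext t
    simp only [Set.mem_image, Set.mem_Ioi]
    constructor
    · rintro ⟨x, hx, rfl⟩; positivity
    · intro ht
      refine ⟨(Real.sqrt t)⁻¹, by positivity, ?_⟩
      rw [inv_pow, inv_inv, Real.sq_sqrt ht.le]
  rw [h1]
  conv_lhs => rw [← him]
  rw [lintegral_image_eq_lintegral_abs_deriv_mul (f' := fun x => -(2 * x) / (x ^ 2) ^ 2)
    measurableSet_Ioi]
  · refine setLIntegral_congr_fun measurableSet_Ioi ?_
    intro x hx
    have hx : 0 < x := hx
    simp only
    rw [← ENNReal.ofReal_mul (abs_nonneg _)]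
    congr 1
    have hp : 0 < (x ^ 2)⁻¹ := by positivity
    rw [igDens, if_pos hp]
    have e1 : Real.sqrt (2 * Real.pi * (x ^ 2)⁻¹ ^ 3) = Real.sqrt (2 * Real.pi) * (x ^ 3)⁻¹ := by
      rw [Real.sqrt_mul (by positivity)]
      congr 1
      rw [← Real.sqrt_sq (by positivity : 0 ≤ (x^3)⁻¹)]
      congr 1
      field_simp
    have e2 : |-(2 * x) / (x ^ 2) ^ 2| = 2 * x / x ^ 4 := by
      rw [neg_div, abs_neg, abs_of_pos (by positivity)]; ring
    have e3 : -(a - c * (x ^ 2)⁻¹) ^ 2 / (2 * (x ^ 2)⁻¹) = -(a * x - c / x) ^ 2 / 2 := by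
      field_simp
    have : Real.sqrt (2 * Real.pi) ≠ 0 := by positivity
    rw [e1, e2, e3]
    field_simp
  · intro x hx
    have hx : 0 < x := hx
    have := ((hasDerivAt_pow 2 x).inv (by positivity)).hasDerivWithinAt (s := Set.Ioi 0)
    exact this.congr_deriv (by simp)
  · intro x hx y hy hxy
    have hx : 0 < x := hx
    have hy : 0 < y := hy
    exact (pow_left_inj₀ hx.le hy.le two_ne_zero).mp (inv_injective hxy)

lemma gauss_lint : ∫⁻ u : ℝ, ENNReal.ofReal (1 / Real.sqrt (2 * Real.pi) * Real.exp (- u ^ 2 / 2))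
    = 1 := by
  have := ProbabilityTheory.lintegral_gaussianPDFReal_eq_one 0 (v := 1) one_ne_zero
  rw [← this]
  simp [ProbabilityTheory.gaussianPDFReal]

lemma gauss_half : ∫⁻ u in Set.Ioi (0:ℝ), ENNReal.ofReal
    (1 / Real.sqrt (2 * Real.pi) * Real.exp (- u ^ 2 / 2)) = 1 / 2 := by
  set f : ℝ → ENNReal := fun u => ENNReal.ofReal
    (1 / Real.sqrt (2 * Real.pi) * Real.exp (- u ^ 2 / 2)) with hf
  have h1 : ∫⁻ u in Set.Ioi (0:ℝ), f u = ∫⁻ u in Set.Iio (0:ℝ), f u := by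
    have := lintegral_image_eq_lintegral_abs_deriv_mul (f := fun x : ℝ => -x) (f' := fun _ => -1)
      (s := Set.Iio 0) measurableSet_Iio (fun x _ => (hasDerivAt_neg x).hasDerivWithinAt)
      neg_injective.injOn f
    simpa [hf] using this
  have h2 : ∫⁻ u in Set.Iio (0:ℝ), f u = ∫⁻ u in (Set.Ioi (0:ℝ))ᶜ, f u := by
    rw [Set.compl_Ioi]
    exact setLIntegral_congr Iio_ae_eq_Iic
  have h3 := lintegral_add_compl (μ := volume) f (measurableSet_Ioi (a := (0:ℝ)))
  rw [← h2, ← h1, gauss_lint, ← two_mul] at h3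
  rw [ENNReal.eq_div_iff (by norm_num) (by norm_num)]
  exact h3

lemma cauchy_schlomilch (a c : ℝ) (ha : 0 < a) (hc : 0 ≤ c) :
    ∫⁻ x in Set.Ioi (0:ℝ), ENNReal.ofReal a * ENNReal.ofReal
        (1 / Real.sqrt (2 * Real.pi) * Real.exp (-(a * x - c / x) ^ 2 / 2)) = 1 / 2 := by
  set f : ℝ → ENNReal := fun u => ENNReal.ofReal
    (1 / Real.sqrt (2 * Real.pi) * Real.exp (- u ^ 2 / 2)) with hf
  change ∫⁻ x in Set.Ioi (0:ℝ), ENNReal.ofReal a * f (a * x - c / x) = 1 / 2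
  have hfm : Measurable f := by
    rw [hf]; fun_prop
  rcases hc.eq_or_lt with rfl | hc
  · have him : (fun x : ℝ => a * x) '' Set.Ioi 0 = Set.Ioi 0 := by
      ext t
      simp only [Set.mem_image, Set.mem_Ioi]
      constructor
      · rintro ⟨x, hx, rfl⟩; positivity
      · intro ht
        exact ⟨t / a, by positivity, by field_simp⟩
    have := lintegral_image_eq_lintegral_abs_deriv_mul (f := fun x : ℝ => a * x) (f' := fun _ => a)
      (s := Set.Ioi 0) measurableSet_Ioi
      (fun x _ => by simpa using ((hasDerivAt_id x).const_mul a).hasDerivWithinAt)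
      (mul_right_injective₀ ha.ne').injOn f
    rw [him, gauss_half, abs_of_pos ha] at this
    simpa using this.symm
  · have him : (fun x : ℝ => a * x - c / x) '' Set.Ioi 0 = Set.univ := by
      ext u
      simp only [Set.mem_image, Set.mem_Ioi, Set.mem_univ, iff_true]
      have hsq : Real.sqrt (u ^ 2 + 4 * a * c) ^ 2 = u ^ 2 + 4 * a * c :=
        Real.sq_sqrt (by positivity)
      have hlt : |u| < Real.sqrt (u ^ 2 + 4 * a * c) := by
        apply Real.lt_sqrt_of_sq_lt
        rw [sq_abs]
        have : 0 < 4 * a * c := by positivity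
        linarith
      have hpos : 0 < u + Real.sqrt (u ^ 2 + 4 * a * c) := by
        have := neg_abs_le u
        linarith
      refine ⟨(u + Real.sqrt (u ^ 2 + 4 * a * c)) / (2 * a), by positivity, ?_⟩
      set r := Real.sqrt (u ^ 2 + 4 * a * c)
      field_simp
      nlinarith
    have hinj : Set.InjOn (fun x : ℝ => a * x - c / x) (Set.Ioi 0) := by
      intro x hx y hy hxy
      have hx : 0 < x := hx
      have hy : 0 < y := hy
      simp only at hxy
      have : (x - y) * (a * x * y + c) = 0 := by
        field_simp at hxy
        linarith
      rcases mul_eq_zero.mp this with h | h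
      · linarith
      · have : 0 < a * x * y + c := by positivity
        linarith
    have h1 := lintegral_image_eq_lintegral_abs_deriv_mul (f := fun x : ℝ => a * x - c / x)
      (f' := fun x => a + c / x ^ 2)
      (s := Set.Ioi 0) measurableSet_Ioi
      (fun x hx => by
        have hx : 0 < x := hx
        have := (((hasDerivAt_id x).const_mul a).sub
          ((hasDerivAt_inv hx.ne').const_mul c)).hasDerivWithinAt (s := Set.Ioi 0)
        exact this.congr_deriv (by simp; ring)) hinj f
    rw [him, Measure.restrict_univ, gauss_lint] at h1
    have him2 : (fun x : ℝ => c / (a * x)) '' Set.Ioi 0 = Set.Ioi 0 := by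
      ext t
      simp only [Set.mem_image, Set.mem_Ioi]
      constructor
      · rintro ⟨x, hx, rfl⟩; positivity
      · intro ht
        exact ⟨c / (a * t), by positivity, by field_simp⟩
    have hinj2 : Set.InjOn (fun x : ℝ => c / (a * x)) (Set.Ioi 0) := by
      intro x hx y hy hxy
      have hx : 0 < x := hx
      have hy : 0 < y := hy
      simp only at hxy
      field_simp at hxy
      linarith
    have h2 := lintegral_image_eq_lintegral_abs_deriv_mul (f := fun x : ℝ => c / (a * x))
      (f' := fun x => - (c / (a * x ^ 2)))
      (s := Set.Ioi 0) measurableSet_Ioi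
      (fun x hx => by
        have hx : 0 < x := hx
        have := ((hasDerivAt_inv hx.ne').const_mul (c / a)).hasDerivWithinAt (s := Set.Ioi 0)
        have hfun : (fun x : ℝ => c / (a * x)) = fun y => c / a * y⁻¹ := by
          ext y; rw [div_mul_eq_div_div, div_eq_mul_inv (c / a)]
        rw [hfun]
        exact this.congr_deriv (by field_simp)) hinj2 (fun x => ENNReal.ofReal a * f (a * x - c / x))
    rw [him2] at h2
    have h3 : ∫⁻ x in Set.Ioi (0:ℝ), ENNReal.ofReal |-(c / (a * x ^ 2))| *
        (ENNReal.ofReal a * f (a * (c / (a * x)) - c / (c / (a * x)))) =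
        ∫⁻ x in Set.Ioi (0:ℝ), ENNReal.ofReal (c / x ^ 2) * f (a * x - c / x) := by
      refine setLIntegral_congr_fun measurableSet_Ioi ?_
      intro x hx
      have hx : 0 < x := hx
      simp only
      rw [← mul_assoc, ← ENNReal.ofReal_mul (abs_nonneg _), abs_neg, abs_of_pos (by positivity)]
      have e1 : c / (a * x ^ 2) * a = c / x ^ 2 := by field_simp
      have e2 : a * (c / (a * x)) - c / (c / (a * x)) = -(a * x - c / x) := by field_simp; ring
      rw [e1, e2]
      simp only [hf, neg_sq]
    rw [h3] at h2
    have h4 : ∫⁻ x in Set.Ioi (0:ℝ), ENNReal.ofReal |a + c / x ^ 2| * f (a * x - c / x) =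
       ∫⁻ x in Set.Ioi (0:ℝ), (ENNReal.ofReal a * f (a * x - c / x) +
        ENNReal.ofReal (c / x ^ 2) * f (a * x - c / x)) := by
      refine setLIntegral_congr_fun measurableSet_Ioi ?_
      intro x hx
      have hx : 0 < x := hx
      simp only
      rw [abs_of_pos (by positivity), ENNReal.ofReal_add ha.le (by positivity), add_mul]
    rw [h4, lintegral_add_left (by fun_prop), ← h2, ← two_mul] at h1
    rw [ENNReal.eq_div_iff (by norm_num) (by norm_num)]
    exact h1.symm

lemma igDens_lintegral (a c : ℝ) (ha : 0 < a) (hc : 0 ≤ c) :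
    ∫⁻ t, ENNReal.ofReal (igDens a c t) = 1 := by
  rw [igDens_lintegral_eq a c ha]
  have : ∀ x : ℝ, ENNReal.ofReal
        (2 * a / Real.sqrt (2 * Real.pi) * Real.exp (-(a * x - c / x) ^ 2 / 2)) =
      2 * (ENNReal.ofReal a * ENNReal.ofReal
        (1 / Real.sqrt (2 * Real.pi) * Real.exp (-(a * x - c / x) ^ 2 / 2))) := by
    intro x
    rw [← ENNReal.ofReal_mul ha.le, ← ENNReal.ofReal_ofNat, ← ENNReal.ofReal_mul (by norm_num)]
    congr 1
    ring
  simp only [this]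
  rw [lintegral_const_mul _ (by fun_prop), cauchy_schlomilch a c ha hc]
  exact ENNReal.mul_div_cancel (by norm_num) (by norm_num)

/-- change of variables for the `i`-th coordinate -/
lemma beta_to_t (w : ℝ) (F : ℝ → ENNReal) :
    ∫⁻ b in Set.Ioi (w / 2), F (1 / (2 * b - w)) =
      ∫⁻ t in Set.Ioi (0:ℝ), ENNReal.ofReal (1 / (2 * t ^ 2)) * F t := by
  have him : (fun t : ℝ => (t⁻¹ + w) / 2) '' Set.Ioi 0 = Set.Ioi (w / 2) := by
    ext b
    simp only [Set.mem_image, Set.mem_Ioi]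
    constructor
    · rintro ⟨x, hx, rfl⟩
      have : 0 < x⁻¹ := by positivity
      linarith
    · intro hb
      have : 0 < 2 * b - w := by linarith
      refine ⟨(2 * b - w)⁻¹, by positivity, ?_⟩
      rw [inv_inv]; ring
  rw [← him, lintegral_image_eq_lintegral_abs_deriv_mul (f' := fun t => -(1 / (2 * t ^ 2)))
    measurableSet_Ioi]
  · refine setLIntegral_congr_fun measurableSet_Ioi ?_
    intro t ht
    have ht : 0 < t := ht
    simp only
    rw [abs_neg, abs_of_pos (by positivity)]
    congr 2
    field_simp
    ring
  · intro t ht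
    have ht : 0 < t := ht
    have := (((hasDerivAt_inv ht.ne').add_const w).div_const 2).hasDerivWithinAt (s := Set.Ioi 0)
    exact this.congr_deriv (by rw [one_div, mul_inv]; ring)
  · intro x hx y hy hxy
    simp only at hxy
    have : x⁻¹ = y⁻¹ := by linarith
    exact inv_injective this

/-- glue a coordinate -/
def glueAt [DecidableEq V] (i : V) (a : ℝ) (b : {j // j ≠ i} → ℝ) : V → ℝ :=
  fun j => if h : j = i then a else b ⟨j, h⟩

lemma glueAt_self [DecidableEq V] (i : V) (a : ℝ) (b : {j // j ≠ i} → ℝ) : glueAt i a b i = a := by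
  simp [glueAt]

lemma glueAt_ne [DecidableEq V] (i : V) (a : ℝ) (b : {j // j ≠ i} → ℝ) (j : {j // j ≠ i}) :
    glueAt i a b j = b j := by
  simp [glueAt, j.2]

lemma lintegral_glueAt [Fintype V] [DecidableEq V] (i : V) (F : (V → ℝ) → ENNReal)
    (hF : Measurable F) :
    ∫⁻ β, F β = ∫⁻ a : ℝ, ∫⁻ b : {j // j ≠ i} → ℝ, F (glueAt i a b) := by
  have h1 := (volume_preserving_piEquivPiSubtypeProd (fun _ : V => ℝ) (fun j => j = i)).symm
  have h2 : MeasurePreserving (MeasurableEquiv.funUnique {j // j = i} ℝ).symm volume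
      (@volume _ (@MeasureSpace.pi _ (Subtype.fintype fun j => j = i) _ _)) := by
    convert (volume_preserving_funUnique {j // j = i} ℝ).symm
  have h3 := h2.prod (MeasurePreserving.id (volume : Measure ({j // j ≠ i} → ℝ)))
  have h4 := h1.comp h3
  rw [← h4.lintegral_comp hF]
  have hg : ∀ p : ℝ × ({j // j ≠ i} → ℝ),
      ((MeasurableEquiv.piEquivPiSubtypeProd (fun _ : V => ℝ) (fun j => j = i)).symm ∘
        Prod.map (MeasurableEquiv.funUnique {j // j = i} ℝ).symm id) p = glueAt i p.1 p.2 := by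
    intro p
    ext j
    rfl
  have hm : Measurable fun p : ℝ × ({j // j ≠ i} → ℝ) => F (glueAt i p.1 p.2) := by
    simp only [← hg]
    exact hF.comp h4.measurable
  simp only [hg]
  rw [lintegral_prod _ hm.aemeasurable]

lemma measurable_Hmat [Fintype V] [DecidableEq V] (W : Matrix V V ℝ) :
    Continuous (fun β : V → ℝ => Hmat W β) := by
  unfold Hmat
  refine Continuous.sub ?_ continuous_const
  refine Continuous.matrix_diagonal ?_
  fun_prop

lemma Hmat_symm [Fintype V] [DecidableEq V] (W : Matrix V V ℝ) (hW : W.IsSymm) (β : V → ℝ) :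
    (Hmat W β).IsSymm := by
  unfold Hmat
  exact (isSymm_diagonal _).sub hW

lemma measurable_nuDensity [Fintype V] [DecidableEq V] (W : Matrix V V ℝ) (hW : W.IsSymm)
    (θ η : V → ℝ) : Measurable (nuDensity W θ η) := by
  have hc := measurable_Hmat W
  have hset : MeasurableSet {β : V → ℝ | (Hmat W β).PosDef} := by
    have : {β : V → ℝ | (Hmat W β).PosDef} =
        {β | (Hmat W β).det ≠ 0} ∩ ⋂ x : V → ℝ, {β | 0 ≤ x ⬝ᵥ Hmat W β *ᵥ x} := by
      ext β
      simp only [Set.mem_ofPred_eq, Set.mem_inter_iff, Set.mem_iInter]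
      constructor
      · intro h
        exact ⟨h.det_pos.ne', fun x => by simpa using h.posSemidef.dotProduct_mulVec_nonneg x⟩
      · rintro ⟨h1, h2⟩
        have hs : (Hmat W β).PosSemidef :=
          .of_dotProduct_mulVec_nonneg (Hmat_symm W hW β) (by simpa using h2)
        rw [hs.posDef_iff_isUnit, isUnit_iff_isUnit_det]
        exact isUnit_iff_ne_zero.mpr h1
    rw [this]
    refine MeasurableSet.inter ?_ (IsClosed.measurableSet (isClosed_iInter fun x => ?_))
    · exact (isOpen_ne_fun hc.matrix_det continuous_const).measurableSet
    · refine isClosed_le continuous_const ?_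
      exact Continuous.dotProduct continuous_const (hc.matrix_mulVec continuous_const)
  unfold nuDensity
  refine Measurable.indicator ?_ hset
  have hdet : Measurable fun β : V → ℝ => (Hmat W β).det := hc.matrix_det.measurable
  have h1 : Measurable fun β : V → ℝ => θ ⬝ᵥ Hmat W β *ᵥ θ :=
    (Continuous.dotProduct continuous_const (hc.matrix_mulVec continuous_const)).measurable
  have h2 : Measurable fun β : V → ℝ => η ⬝ᵥ (Hmat W β)⁻¹ *ᵥ η := by
    have : (fun β : V → ℝ => η ⬝ᵥ (Hmat W β)⁻¹ *ᵥ η) =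
        fun β => (Hmat W β).det⁻¹ * (η ⬝ᵥ (Hmat W β).adjugate *ᵥ η) := by
      ext β
      rw [Matrix.inv_def, smul_mulVec, dotProduct_smul, Ring.inverse_eq_inv', smul_eq_mul]
    rw [this]
    exact hdet.inv.mul (Continuous.dotProduct continuous_const
      (hc.matrix_adjugate.matrix_mulVec continuous_const)).measurable
  fun_prop

/-- the reduced `W` -/
noncomputable def redW [Fintype V] [DecidableEq V] (W : Matrix V V ℝ) (i : V) (h : ℝ) :
    Matrix {j // j ≠ i} {j // j ≠ i} ℝ :=
  fun j k => W j k + W j i * W i k / h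

lemma schurAt_Hmat [Fintype V] [DecidableEq V] (W : Matrix V V ℝ) (i : V) (a : ℝ)
    (b : {j // j ≠ i} → ℝ) :
    schurAt (Hmat W (glueAt i a b)) i = Hmat (redW W i (2 * a - W i i)) b := by
  ext j k
  have hj := j.2
  have hk := k.2
  by_cases hjk : j = k
  · subst hjk
    simp [schurAt, Hmat, redW, glueAt_self, glueAt_ne, hj, Ne.symm hj]
    ring
  · have hjk' : (j : V) ≠ k := fun h => hjk (Subtype.ext h)
    simp [schurAt, Hmat, redW, glueAt_self, hj, Ne.symm hk, hjk, hjk']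
    ring

lemma nuDensity_glueAt [Fintype V] [DecidableEq V] (W : Matrix V V ℝ) (hW : W.IsSymm)
    (θ η : V → ℝ) (i : V) (a : ℝ) (b : {j // j ≠ i} → ℝ) (ha : 0 < 2 * a - W i i) :
    nuDensity W θ η (glueAt i a b) =
      (2 / Real.pi) ^ ((1 : ℝ) / 2) * θ i / Real.sqrt (2 * a - W i i) *
        Real.exp (-(θ i - (η i + ∑ j ∈ Finset.univ.erase i, W i j * θ j) *
          (1 / (2 * a - W i i))) ^ 2 / (2 * (1 / (2 * a - W i i)))) *
      nuDensity (redW W i (2 * a - W i i)) (fun j => θ j)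
        (fun j => η j + W j i * η i / (2 * a - W i i)) b := by
  set A := Hmat W (glueAt i a b) with hA
  have hAs : A.IsSymm := Hmat_symm W hW _
  have hAii : A i i = 2 * a - W i i := by simp [hA, Hmat, glueAt_self]
  have hAji : ∀ j : {j // j ≠ i}, A j i = - W j i := by
    intro j; simp [hA, Hmat, j.2]
  have hAij : ∀ j : {j // j ≠ i}, A i j = - W i j := by
    intro j; simp [hA, Hmat, Ne.symm j.2]
  have hpd := posDef_iff_schurAt A hAs i
  have hS : schurAt A i = Hmat (redW W i (2 * a - W i i)) b := schurAt_Hmat W i a b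
  rw [hS, hAii] at hpd
  have hne : A i i ≠ 0 := by rw [hAii]; exact ha.ne'
  set h := 2 * a - W i i with hh
  by_cases hp : A.PosDef
  · have hp' := (hpd.mp hp).2
    have hdet := det_schurAt A i hne
    have hq := quad_schurAt A hAs i hne θ
    have hiq := inv_quad_schurAt A hAs i hne (by rw [hS]; exact hp'.det_pos.ne') η
    rw [hS, hAii] at hdet hq hiq
    simp only [hAji, hAij] at hq hiq
    have e1 : nuDensity W θ η (glueAt i a b) = (2 / Real.pi) ^ ((Fintype.card V : ℝ) / 2) *
        Real.exp (-(1 / 2) * (θ ⬝ᵥ A *ᵥ θ)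
          - (1 / 2) * (η ⬝ᵥ A⁻¹ *ᵥ η) + η ⬝ᵥ θ) *
        (∏ i, θ i) / Real.sqrt A.det := by
      rw [nuDensity, Set.indicator_of_mem (by exact hp)]
    rw [e1, nuDensity, Set.indicator_of_mem (by exact hp'), hdet, hq, hiq]
    have hcard : (2 / Real.pi : ℝ) ^ ((Fintype.card V : ℝ) / 2) = (2 / Real.pi) ^ ((1 : ℝ) / 2) *
        (2 / Real.pi) ^ ((Fintype.card {j // j ≠ i} : ℝ) / 2) := by
      rw [← Real.rpow_add (by positivity)]
      congr 1
      have : Fintype.card V = Fintype.card {j // j ≠ i} + 1 := by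
        have h0 : 0 < Fintype.card V := Fintype.card_pos_iff.mpr ⟨i⟩
        have := Set.card_ne_eq i
        simp only [ne_eq, Fintype.card_subtype_compl, Fintype.card_unique]
        omega
      rw [this]; push_cast; ring
    have hprod : ∏ j, θ j = θ i * ∏ j : {j // j ≠ i}, θ j :=
      Fintype.prod_eq_mul_prod_subtype_ne _ i
    have hηθ : η ⬝ᵥ θ = η i * θ i + ∑ j : {j // j ≠ i}, η j * θ j :=
      Fintype.sum_eq_add_sum_subtype_ne _ i
    have hs : ∑ j ∈ Finset.univ.erase i, W i j * θ j = ∑ j : {j // j ≠ i}, W i j * θ j := by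
      have h1 := Fintype.sum_eq_add_sum_subtype_ne (fun j => W i j * θ j) i
      rw [← Finset.add_sum_erase _ _ (Finset.mem_univ i)] at h1
      linarith
    have hη2 : (fun j : {j // j ≠ i} => η j + W j i * η i / h) ⬝ᵥ (fun j : {j // j ≠ i} => θ j) =
        ∑ j : {j // j ≠ i}, η j * θ j + η i / h * ∑ j : {j // j ≠ i}, W i j * θ j := by
      simp only [dotProduct, add_mul, Finset.sum_add_distrib, Finset.mul_sum]
      congr 1
      refine Finset.sum_congr rfl fun j _ => ?_
      rw [hW.apply i j]; ring
    have hη3 : (fun j : {j // j ≠ i} => η j - -W j i * η i / h) =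
        (fun j : {j // j ≠ i} => η j + W j i * η i / h) := by
      ext j; ring
    have hneg : ∑ j : {j // j ≠ i}, -W i j * θ j = - ∑ j : {j // j ≠ i}, W i j * θ j := by
      simp
    rw [hcard, hprod, hηθ, hs, hη2, hη3, hneg, Real.sqrt_mul ha.le]
    set s := ∑ j : {j // j ≠ i}, W i j * θ j
    set P := ∑ j : {j // j ≠ i}, η j * θ j
    set Q1 := (fun j : {j // j ≠ i} => θ j) ⬝ᵥ Hmat (redW W i h) b *ᵥ fun j => θ j
    set Q2 := (fun j : {j // j ≠ i} => η j + W j i * η i / h) ⬝ᵥ (Hmat (redW W i h) b)⁻¹ *ᵥ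
      fun j => η j + W j i * η i / h
    have hexp : -(1 / 2) * (h * (θ i + -s / h) ^ 2 + Q1) - 1 / 2 * (η i ^ 2 / h + Q2) +
        (η i * θ i + P) = (-(θ i - (η i + s) * (1 / h)) ^ 2 / (2 * (1 / h))) +
        (-(1 / 2) * Q1 - 1 / 2 * Q2 + (P + η i / h * s)) := by
      field_simp
      ring
    rw [hexp, Real.exp_add]
    ring
  · have hp' : ¬ (Hmat (redW W i h) b).PosDef := fun h' => hp (hpd.mpr ⟨ha, h'⟩)
    rw [nuDensity, Set.indicator_of_notMem (by exact hp), nuDensity,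
      Set.indicator_of_notMem (by exact hp'), mul_zero]

lemma nuDensity_glueAt_zero [Fintype V] [DecidableEq V] (W : Matrix V V ℝ)
    (θ η : V → ℝ) (i : V) (a : ℝ) (b : {j // j ≠ i} → ℝ) (ha : ¬ 0 < 2 * a - W i i) :
    nuDensity W θ η (glueAt i a b) = 0 := by
  rw [nuDensity, Set.indicator_of_notMem]
  intro hp
  have hp : (Hmat W (glueAt i a b)).PosDef := hp
  have : 0 < (Hmat W (glueAt i a b)) i i := hp.diag_pos
  simp [Hmat, glueAt_self] at this
  apply ha; linarith

lemma nu_marginal_aux [Fintype V] [DecidableEq V]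
    (W : Matrix V V ℝ) (hWsymm : W.IsSymm) (hWpos : ∀ i j, 0 ≤ W i j)
    (θ η : V → ℝ) (hθ : ∀ i, 0 < θ i) (hη : ∀ i, 0 ≤ η i) (i : V)
    (hmass : ∀ (W' : Matrix {j // j ≠ i} {j // j ≠ i} ℝ) (θ' η' : {j // j ≠ i} → ℝ),
      W'.IsSymm → (∀ i j, 0 ≤ W' i j) → (∀ i, 0 < θ' i) → (∀ i, 0 ≤ η' i) →
      ∫⁻ b, ENNReal.ofReal (nuDensity W' θ' η' b) = 1)
    (g : ℝ → ENNReal) (hg : Measurable g) :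
    ∫⁻ β : V → ℝ, g (1 / (2 * β i - W i i)) * ENNReal.ofReal (nuDensity W θ η β) =
      ∫⁻ t, g t * ENNReal.ofReal
        (igDens (θ i) (η i + ∑ j ∈ Finset.univ.erase i, W i j * θ j) t) := by
  set c := η i + ∑ j ∈ Finset.univ.erase i, W i j * θ j with hc
  have hmeas := measurable_nuDensity W hWsymm θ η
  rw [lintegral_glueAt i _ (by fun_prop)]
  let K : ℝ → ℝ := fun t => (2 / Real.pi) ^ ((1 : ℝ) / 2) * θ i / Real.sqrt (1 / t) *
        Real.exp (-(θ i - c * t) ^ 2 / (2 * t))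
  have h1 : ∀ a : ℝ, ∫⁻ b : {j // j ≠ i} → ℝ, g (1 / (2 * glueAt i a b i - W i i)) *
      ENNReal.ofReal (nuDensity W θ η (glueAt i a b)) =
      (Set.Ioi (W i i / 2)).indicator (fun a => g (1 / (2 * a - W i i)) *
        ENNReal.ofReal (K (1 / (2 * a - W i i)))) a := by
    intro a
    by_cases ha : 0 < 2 * a - W i i
    · rw [Set.indicator_of_mem (by rw [Set.mem_Ioi]; linarith)]
      simp only [glueAt_self, nuDensity_glueAt W hWsymm θ η i a _ ha]
      have hK : 0 ≤ (2 / Real.pi) ^ ((1 : ℝ) / 2) * θ i / Real.sqrt (2 * a - W i i) *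
        Real.exp (-(θ i - (η i + ∑ j ∈ Finset.univ.erase i, W i j * θ j) *
          (1 / (2 * a - W i i))) ^ 2 / (2 * (1 / (2 * a - W i i)))) := by
        have := hθ i
        positivity
      simp only [ENNReal.ofReal_mul hK, ← mul_assoc]
      have hsy : (redW W i (2 * a - W i i)).IsSymm := by
        ext j k
        simp only [redW, transpose_apply]
        rw [hWsymm.apply j k, hWsymm.apply i k, hWsymm.apply j i]; ring
      rw [lintegral_const_mul, hmass _ _ _ hsy, mul_one]
      · simp only [K, one_div_one_div]
        rw [hc]
      · intro j k
        have := hWpos j k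
        have := hWpos j i
        have := hWpos i k
        unfold redW
        positivity
      · intro j; exact hθ j
      · intro j
        have := hη j
        have := hη i
        have := hWpos j i
        positivity
      · exact (measurable_nuDensity _ hsy _ _).ennreal_ofReal
    · rw [Set.indicator_of_notMem (by rw [Set.mem_Ioi]; intro h; apply ha; linarith)]
      simp [nuDensity_glueAt_zero W θ η i a _ ha]
  simp only [h1]
  rw [lintegral_indicator measurableSet_Ioi,
    beta_to_t (W i i) (fun t => g t * ENNReal.ofReal (K t)), ← lintegral_indicator measurableSet_Ioi]
  congr 1
  ext t
  by_cases ht : 0 < t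
  · rw [Set.indicator_of_mem (by exact ht), mul_left_comm, ← ENNReal.ofReal_mul (by positivity)]
    congr 2
    simp only [K, igDens, if_pos ht]
    rw [← mul_assoc]
    congr 1
    have e1 : Real.sqrt (2 * Real.pi * t ^ 3) = Real.sqrt 2 * Real.sqrt Real.pi * (t * Real.sqrt t) := by
      rw [Real.sqrt_mul (by positivity), Real.sqrt_mul (by positivity)]
      congr 1
      rw [show t ^ 3 = t ^ 2 * t by ring, Real.sqrt_mul (by positivity), Real.sqrt_sq ht.le]
    rw [e1, ← Real.sqrt_eq_rpow, Real.sqrt_div (by positivity), Real.sqrt_div (by positivity),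
      Real.sqrt_one]
    have h2 : Real.sqrt 2 * Real.sqrt 2 = 2 := Real.mul_self_sqrt (by norm_num)
    have h3 : Real.sqrt t * Real.sqrt t = t := Real.mul_self_sqrt ht.le
    have h4 : 0 < Real.sqrt t := by positivity
    have h5 : 0 < Real.sqrt Real.pi := by positivity
    field_simp
    linear_combination (Real.sqrt t ^ 2 * θ i) * h2 + 2 * θ i * h3
  · rw [Set.indicator_of_notMem (by exact ht)]
    simp [igDens, ht]

universe u

lemma nu_mass (n : ℕ) : ∀ (V : Type u) [Fintype V] [DecidableEq V], Fintype.card V = n →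
    ∀ (W : Matrix V V ℝ) (θ η : V → ℝ),
      W.IsSymm → (∀ i j, 0 ≤ W i j) → (∀ i, 0 < θ i) → (∀ i, 0 ≤ η i) →
      ∫⁻ b, ENNReal.ofReal (nuDensity W θ η b) = 1 := by
  induction n with
  | zero =>
    intro V _ _ hV W θ η hW _ _ _
    have : IsEmpty V := Fintype.card_eq_zero_iff.mp hV
    have h1 : ∀ b, nuDensity W θ η b = 1 := by
      intro b
      have hp : (Hmat W b).PosDef :=
        .of_dotProduct_mulVec_pos (Hmat_symm W hW b) (fun x hx => (hx (Subsingleton.elim _ _)).elim)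
      rw [nuDensity, Set.indicator_of_mem (by exact hp)]
      simp
    simp [h1, volume_pi]
  | succ n ih =>
    intro V _ _ hV W θ η hW hWp hθ hη
    have : Nonempty V := Fintype.card_pos_iff.mp (by omega)
    obtain ⟨i⟩ := this
    have := nu_marginal_aux W hW hWp θ η hθ hη i
      (fun W' θ' η' => ih {j // j ≠ i} (by
        simp only [ne_eq, Fintype.card_subtype_compl, Fintype.card_unique]
        omega) W' θ' η') (fun _ => 1) measurable_const
    simp only [one_mul] at this
    rw [this]
    refine igDens_lintegral _ _ (hθ i) ?_
    have h2 : 0 ≤ ∑ j ∈ Finset.univ.erase i, W i j * θ j :=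
      Finset.sum_nonneg fun j _ => mul_nonneg (hWp i j) (hθ j).le
    have := hη i
    positivity

/-- The marginal of `1/(2β_i − W_{i,i})` under `ν_V^{W,θ,η}` is the Inverse Gaussian
distribution `IG(θ_i / c_i, θ_i²)` where `c_i = η_i + ∑_{j ≠ i} W_{i,j} θ_j`. -/
theorem nu_marginal_inverseGaussian [Fintype V] [DecidableEq V] [Nonempty V]
    (W : Matrix V V ℝ) (hWsymm : W.IsSymm) (hWpos : ∀ i j, 0 ≤ W i j)
    (θ η : V → ℝ) (hθ : ∀ i, 0 < θ i) (hη : ∀ i, 0 ≤ η i) (i : V) :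
    Measure.map (fun β : V → ℝ => 1 / (2 * β i - W i i)) (nu W θ η) =
      volume.withDensity (fun t : ℝ => ENNReal.ofReal
        (if 0 < t then
          θ i / Real.sqrt (2 * Real.pi * t ^ 3) *
            Real.exp (-(θ i - (η i + ∑ j ∈ Finset.univ.erase i, W i j * θ j) * t) ^ 2 / (2 * t))
        else 0)) := by
  have hmeas := (measurable_nuDensity W hWsymm θ η).ennreal_ofReal
  have hf : Measurable (fun β : V → ℝ => 1 / (2 * β i - W i i)) := by fun_prop
  ext s hs
  rw [Measure.map_apply hf hs, nu, withDensity_apply _ (hf hs), withDensity_apply _ hs,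
    ← lintegral_indicator (hf hs), ← lintegral_indicator hs]
  have := nu_marginal_aux W hWsymm hWpos θ η hθ hη i
      (fun W' θ' η' => nu_mass _ {j // j ≠ i} rfl W' θ' η') (s.indicator fun _ => 1)
      (measurable_const.indicator hs)
  refine Eq.trans (lintegral_congr fun β => ?_) (this.trans (lintegral_congr fun t => ?_))
  · by_cases h : 1 / (2 * β i - W i i) ∈ s
    · rw [Set.indicator_of_mem (by exact h), Set.indicator_of_mem h, one_mul]
    · rw [Set.indicator_of_notMem (by exact h), Set.indicator_of_notMem h, zero_mul]
  · by_cases h : t ∈ s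
    · rw [Set.indicator_of_mem h, Set.indicator_of_mem h, one_mul, igDens]
    · rw [Set.indicator_of_notMem h, Set.indicator_of_notMem h, zero_mul]
end

section
/- Let θ > 0 and η ≥ 0, and let τ(ω) = inf{t ≥ 0 : θ + B_t(ω) − η t = 0}. Then τ < ∞ almost surely, and the law of τ (the pushforward of P under τ) is the measure on ℝ with density t ↦ 1_{t>0} · θ/√(2π t³) · exp(−(θ − η t)²/(2t)), i.e. the Inverse Gaussian distribution IG(θ/η, θ²). -/
open MeasureTheory ProbabilityTheory

/-- A standard one-dimensional Brownian motion on a probability space `(Ω, F, P)`: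
almost surely continuous paths on `[0,∞)`, `B_0 = 0`, and for `0 ≤ s ≤ t` the increment
`B_t − B_s` has Gaussian law `N(0, t − s)` and is independent of `(B_r)_{0 ≤ r ≤ s}`. -/
structure IsStdBrownianMotion {Ω : Type*} [MeasurableSpace Ω]
    (P : Measure Ω) (B : ℝ → Ω → ℝ) : Prop where
  isProbability : IsProbabilityMeasure P
  measurable : ∀ t, Measurable (B t)
  cont : ∀ᵐ ω ∂P, ContinuousOn (fun t => B t ω) (Set.Ici 0)
  init : ∀ᵐ ω ∂P, B 0 ω = 0
  incr_law : ∀ s t : ℝ, 0 ≤ s → s ≤ t →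
    Measure.map (fun ω => B t ω - B s ω) P = gaussianReal 0 (Real.toNNReal (t - s))
  incr_indep : ∀ s t : ℝ, 0 ≤ s → s ≤ t →
    Indep (MeasurableSpace.comap (fun ω => B t ω - B s ω) inferInstance)
      (⨆ r ∈ Set.Icc (0 : ℝ) s, MeasurableSpace.comap (B r) inferInstance) P


/-- standard normal cdf -/
noncomputable def stdPhi (x : ℝ) : ℝ := cdf (gaussianReal 0 1) x

lemma stdPhi_eq (x : ℝ) : stdPhi x = ∫ t in Set.Iic x, gaussianPDFReal 0 1 t := by
  rw [stdPhi, cdf_eq_real, measureReal_def, gaussianReal_apply_eq_integral _ one_ne_zero,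
    ENNReal.toReal_ofReal]
  exact integral_nonneg (fun t => gaussianPDFReal_nonneg _ _ _)

lemma continuous_pdf01 : Continuous (gaussianPDFReal 0 1) := by
  unfold gaussianPDFReal
  fun_prop

lemma hasDerivAt_stdPhi (x : ℝ) : HasDerivAt stdPhi (gaussianPDFReal 0 1 x) x := by
  have hi : Integrable (gaussianPDFReal 0 1) := integrable_gaussianPDFReal 0 1
  have h : stdPhi = fun u => stdPhi 0 + ∫ t in (0:ℝ)..u, gaussianPDFReal 0 1 t := by
    funext u
    rw [← intervalIntegral.integral_Iic_sub_Iic hi.integrableOn hi.integrableOn, stdPhi_eq,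
      stdPhi_eq]
    ring
  rw [h]
  exact (intervalIntegral.integral_hasDerivAt_right (hi.intervalIntegrable)
    (continuous_pdf01.stronglyMeasurableAtFilter _ _) continuous_pdf01.continuousAt).const_add _

lemma continuous_stdPhi : Continuous stdPhi :=
  continuous_iff_continuousAt.2 fun x => (hasDerivAt_stdPhi x).continuousAt

lemma stdPhi_Iio (x : ℝ) : (gaussianReal 0 1).real (Set.Iio x) = stdPhi x := by
  have := nullSingletonClass_gaussianReal (μ := 0) (v := 1) one_ne_zero
  rw [stdPhi, cdf_eq_real]
  exact measureReal_congr Iio_ae_eq_Iic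

lemma stdPhi_Ioi (x : ℝ) : (gaussianReal 0 1).real (Set.Ioi x) = stdPhi (-x) := by
  rw [← stdPhi_Iio]
  have h : Measure.map (fun x => -x) (gaussianReal 0 1) = gaussianReal 0 1 := by
    rw [gaussianReal_map_neg, neg_zero]
  conv_rhs => rw [← h]
  rw [map_measureReal_apply measurable_neg measurableSet_Iio]
  congr 1
  ext y
  simp

lemma stdPhi_neg (x : ℝ) : stdPhi (-x) = 1 - stdPhi x := by
  rw [← stdPhi_Ioi, stdPhi, cdf_eq_real, ← Set.compl_Iic,
    probReal_compl_eq_one_sub measurableSet_Iic]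

lemma gauss_scale (h : ℝ) (hh : 0 < h) (m : ℝ) :
    gaussianReal m h.toNNReal = Measure.map (fun x => Real.sqrt h * x + m) (gaussianReal 0 1) := by
  have h1 := gaussianReal_map_const_mul (μ := 0) (v := 1) (Real.sqrt h)
  have h2 := gaussianReal_map_add_const (μ := 0) (v := h.toNNReal) m
  have h3 : Measure.map (fun x => Real.sqrt h * x) (gaussianReal 0 1)
      = gaussianReal 0 h.toNNReal := by
    rw [h1, mul_zero]
    congr 1
    ext
    simp [hh.le]
  rw [zero_add] at h2
  rw [← h2, ← h3, Measure.map_map (by fun_prop) (by fun_prop)]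
  rfl

/-- the antisymmetric test function -/
noncomputable def gfun (η : ℝ) (x : ℝ) : ℝ :=
  Set.indicator (Set.Ioi 0) (fun _ => (1:ℝ)) x
    - Set.indicator (Set.Iio 0) (fun x => Real.exp (2 * η * x)) x

lemma measurable_gfun (η : ℝ) : Measurable (gfun η) := by
  unfold gfun
  exact (measurable_const.indicator measurableSet_Ioi).sub
    (Measurable.indicator (by fun_prop) measurableSet_Iio)

lemma abs_gfun_le (η : ℝ) (hη : 0 ≤ η) (x : ℝ) : |gfun η x| ≤ 1 := by
  unfold gfun
  rcases lt_trichotomy x 0 with h | h | h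
  · have : Real.exp (2 * η * x) ≤ 1 := Real.exp_le_one_iff.2 (by nlinarith)
    simp [Set.indicator, h, abs_of_pos (Real.exp_pos _), not_lt.2 h.le, this]
  · simp [h]
  · simp [Set.indicator, h, not_lt.2 h.le]

/-- smoothed test function -/
noncomputable def Gfun (η : ℝ) (x h : ℝ) : ℝ :=
  ∫ y, gfun η (x + y - η * h) ∂(gaussianReal 0 h.toNNReal)

lemma abs_Gfun_le (η : ℝ) (hη : 0 ≤ η) (x h : ℝ) : |Gfun η x h| ≤ 1 := by
  have := norm_integral_le_of_norm_le_const (μ := gaussianReal 0 h.toNNReal)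
    (f := fun y => gfun η (x + y - η * h)) (C := 1)
    (Filter.Eventually.of_forall fun y => abs_gfun_le η hη _)
  simpa [Gfun] using this

lemma Gfun_formula (η : ℝ) (hη : 0 ≤ η) (x h : ℝ) (hh : 0 < h) :
    Gfun η x h = stdPhi ((x - η * h) / Real.sqrt h)
      - Real.exp (2 * η * x) * stdPhi (-(x + η * h) / Real.sqrt h) := by
  have hs : 0 < Real.sqrt h := Real.sqrt_pos.2 hh
  have hv : h.toNNReal ≠ 0 := by simpa using hh
  have e : ∀ y, gfun η (x + y - η * h) =
      Set.indicator (Set.Ioi (η * h - x)) (fun _ => (1:ℝ)) y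
      - Set.indicator (Set.Iio (η * h - x)) (fun y => Real.exp (2 * η * (x + y - η * h))) y := by
    intro y
    unfold gfun
    have h1 : (0 < x + y - η * h) ↔ (η * h - x < y) := by constructor <;> intro <;> linarith
    have h2 : (x + y - η * h < 0) ↔ (y < η * h - x) := by constructor <;> intro <;> linarith
    simp only [Set.indicator, Set.mem_Ioi, Set.mem_Iio, h1, h2]
  have i1 : Integrable (Set.indicator (Set.Ioi (η * h - x)) (fun _ => (1:ℝ)))
      (gaussianReal 0 h.toNNReal) := (integrable_const _).indicator measurableSet_Ioi
  have i2 : Integrable (Set.indicator (Set.Iio (η * h - x))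
      (fun y => Real.exp (2 * η * (x + y - η * h)))) (gaussianReal 0 h.toNNReal) := by
    refine Integrable.of_bound (C := 1) ?_ (Filter.Eventually.of_forall fun y => ?_)
    · exact (Measurable.indicator (by fun_prop) measurableSet_Iio).aestronglyMeasurable
    · by_cases hy : y < η * h - x
      · have : Real.exp (2 * η * (x + y - η * h)) ≤ 1 := Real.exp_le_one_iff.2 (by nlinarith)
        simpa [Set.indicator, hy] using this
      · simp [Set.indicator, hy]
  have c1 : ∫ y, Set.indicator (Set.Ioi (η * h - x)) (fun _ => (1:ℝ)) y
      ∂(gaussianReal 0 h.toNNReal) = stdPhi ((x - η * h) / Real.sqrt h) := by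
    rw [integral_indicator_const _ measurableSet_Ioi, smul_eq_mul, mul_one, gauss_scale h hh,
      map_measureReal_apply (by fun_prop) measurableSet_Ioi]
    have : (fun y => Real.sqrt h * y + 0) ⁻¹' Set.Ioi (η * h - x)
        = Set.Ioi (- ((x - η * h) / Real.sqrt h)) := by
      ext y
      simp only [Set.mem_preimage, Set.mem_Ioi, add_zero]
      rw [← neg_div, div_lt_iff₀ hs, mul_comm y, neg_sub]
    rw [this, stdPhi_Ioi, neg_neg]
  have c2 : ∫ y, Set.indicator (Set.Iio (η * h - x))
      (fun y => Real.exp (2 * η * (x + y - η * h))) y ∂(gaussianReal 0 h.toNNReal)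
      = Real.exp (2 * η * x) * stdPhi (-(x + η * h) / Real.sqrt h) := by
    have a1 : ∫ y, Set.indicator (Set.Iio (η * h - x))
      (fun y => Real.exp (2 * η * (x + y - η * h))) y ∂(gaussianReal 0 h.toNNReal)
      = ∫ y, Set.indicator (Set.Iio (η * h - x)) (fun _ => Real.exp (2 * η * x)) y
          ∂(gaussianReal (2 * η * h) h.toNNReal) := by
      rw [integral_gaussianReal_eq_integral_smul hv, integral_gaussianReal_eq_integral_smul hv]
      congr 1
      funext y
      by_cases hy : y < η * h - x
      · simp only [Set.indicator, Set.mem_Iio, hy, if_true, smul_eq_mul, gaussianPDFReal,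
          Real.coe_toNNReal h hh.le, mul_assoc, ← Real.exp_add]
        congr 2
        field_simp
        ring
      · simp [Set.indicator, hy]
    rw [a1, integral_indicator_const _ measurableSet_Iio, smul_eq_mul, gauss_scale h hh,
      map_measureReal_apply (by fun_prop) measurableSet_Iio]
    have : (fun y => Real.sqrt h * y + 2 * η * h) ⁻¹' Set.Iio (η * h - x)
        = Set.Iio (-(x + η * h) / Real.sqrt h) := by
      ext y
      simp only [Set.mem_preimage, Set.mem_Iio]
      rw [lt_div_iff₀ hs, mul_comm]
      constructor <;> intro <;> linarith
    rw [this, stdPhi_Iio, mul_comm]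
  unfold Gfun
  simp_rw [e]
  rw [integral_sub i1 i2, c1, c2]

lemma Gfun_zero (η : ℝ) (hη : 0 ≤ η) (h : ℝ) (hh : 0 < h) : Gfun η 0 h = 0 := by
  rw [Gfun_formula η hη 0 h hh]
  simp

lemma Gfun_tendsto (η : ℝ) (hη : 0 ≤ η) {ι : Type*} (l : Filter ι) (x h : ι → ℝ) (h0 : ℝ)
    (hh : 0 < h0) (hx : Filter.Tendsto x l (nhds 0)) (hhl : Filter.Tendsto h l (nhds h0)) :
    Filter.Tendsto (fun i => Gfun η (x i) (h i)) l (nhds 0) := by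
  have hs : Real.sqrt h0 ≠ 0 := (Real.sqrt_pos.2 hh).ne'
  have hsq : Filter.Tendsto (fun i => Real.sqrt (h i)) l (nhds (Real.sqrt h0)) :=
    (Real.continuous_sqrt.tendsto _).comp hhl
  have : Filter.Tendsto (fun i => stdPhi ((x i - η * h i) / Real.sqrt (h i))
      - Real.exp (2 * η * x i) * stdPhi (-(x i + η * h i) / Real.sqrt (h i))) l
      (nhds (stdPhi ((0 - η * h0) / Real.sqrt h0)
      - Real.exp (2 * η * 0) * stdPhi (-(0 + η * h0) / Real.sqrt h0))) := by
    refine Filter.Tendsto.sub ?_ (Filter.Tendsto.mul ?_ ?_)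
    · exact (continuous_stdPhi.tendsto _).comp ((hx.sub (hhl.const_mul η)).div hsq hs)
    · exact (Real.continuous_exp.tendsto _).comp (hx.const_mul _)
    · exact (continuous_stdPhi.tendsto _).comp ((hx.add (hhl.const_mul η)).neg.div hsq hs)
  rw [← Gfun_formula η hη 0 h0 hh, Gfun_zero η hη h0 hh] at this
  refine this.congr' ?_
  filter_upwards [hhl.eventually (lt_mem_nhds hh)] with i hi
  rw [Gfun_formula η hη _ _ hi]

/-- the inverse Gaussian cdf -/
noncomputable def igF (θ η : ℝ) (t : ℝ) : ℝ :=
  stdPhi ((η * t - θ) / Real.sqrt t) + Real.exp (2 * η * θ) * stdPhi (-(θ + η * t) / Real.sqrt t)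

lemma igF_eq (θ η : ℝ) (hη : 0 ≤ η) (t : ℝ) (ht : 0 < t) : igF θ η t = 1 - Gfun η θ t := by
  rw [Gfun_formula η hη θ t ht, igF]
  have := stdPhi_neg ((θ - η * t) / Real.sqrt t)
  rw [← neg_div, neg_sub] at this
  rw [this]
  ring

lemma igF_hasDerivAt (θ η : ℝ) (t : ℝ) (ht : 0 < t) :
    HasDerivAt (igF θ η)
      (θ / Real.sqrt (2 * Real.pi * t ^ 3) * Real.exp (-(θ - η * t) ^ 2 / (2 * t))) t := by
  have hs : 0 < Real.sqrt t := Real.sqrt_pos.2 ht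
  have hsq : Real.sqrt t ^ 2 = t := Real.sq_sqrt ht.le
  have ds := Real.hasDerivAt_sqrt ht.ne'
  have d1 : HasDerivAt (fun t => (η * t - θ) / Real.sqrt t)
      ((η * 1 * Real.sqrt t - (η * t - θ) * (1 / (2 * Real.sqrt t))) / Real.sqrt t ^ 2) t :=
    (((hasDerivAt_id t).const_mul η).sub_const θ).div ds hs.ne'
  have d2 : HasDerivAt (fun t => -(θ + η * t) / Real.sqrt t)
      ((-(η * 1) * Real.sqrt t - (-(θ + η * t)) * (1 / (2 * Real.sqrt t))) / Real.sqrt t ^ 2) t :=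
    ((((hasDerivAt_id t).const_mul η).const_add θ).neg).div ds hs.ne'
  have D := ((hasDerivAt_stdPhi _).comp t d1).add
    (((hasDerivAt_stdPhi _).comp t d2).const_mul (Real.exp (2 * η * θ)))
  refine D.congr_deriv ?_
  have e1 : gaussianPDFReal 0 1 ((η * t - θ) / Real.sqrt t)
      = (Real.sqrt (2 * Real.pi))⁻¹ * Real.exp (-(θ - η * t) ^ 2 / (2 * t)) := by
    simp only [gaussianPDFReal, NNReal.coe_one, mul_one, sub_zero, div_pow, hsq]
    congr 2
    field_simp
    ring
  have e2 : Real.exp (2 * η * θ) * gaussianPDFReal 0 1 (-(θ + η * t) / Real.sqrt t)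
      = (Real.sqrt (2 * Real.pi))⁻¹ * Real.exp (-(θ - η * t) ^ 2 / (2 * t)) := by
    simp only [gaussianPDFReal, NNReal.coe_one, mul_one, sub_zero, div_pow, hsq]
    rw [mul_left_comm, ← Real.exp_add]
    congr 2
    field_simp
    ring
  have e3 : Real.sqrt (2 * Real.pi * t ^ 3) = Real.sqrt (2 * Real.pi) * (t * Real.sqrt t) := by
    rw [Real.sqrt_mul (by positivity) (t ^ 3), pow_succ, Real.sqrt_mul (by positivity) t,
      Real.sqrt_sq ht.le]
  rw [← mul_assoc, e1, e2, e3, hsq]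
  have hp : Real.sqrt (2 * Real.pi) ≠ 0 := by positivity
  generalize Real.exp (-(θ - η * t) ^ 2 / (2 * t)) = E
  field_simp
  rw [hsq]
  ring

lemma igF_tendsto_zero (θ η : ℝ) (hθ : 0 < θ) :
    Filter.Tendsto (igF θ η) (nhdsWithin 0 (Set.Ioi 0)) (nhds 0) := by
  have hs : Filter.Tendsto (fun t => (Real.sqrt t)⁻¹) (nhdsWithin 0 (Set.Ioi 0)) Filter.atTop := by
    refine Filter.Tendsto.inv_tendsto_nhdsGT_zero ?_
    refine tendsto_nhdsWithin_iff.2 ⟨?_, ?_⟩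
    · have := (Real.continuous_sqrt.tendsto 0).mono_left (nhdsWithin_le_nhds (s := Set.Ioi 0))
      simpa using this
    · filter_upwards [self_mem_nhdsWithin] with t ht using Real.sqrt_pos.2 ht
  have t1 : Filter.Tendsto (fun t : ℝ => η * t - θ) (nhdsWithin 0 (Set.Ioi 0)) (nhds (-θ)) := by
    have : Continuous (fun t : ℝ => η * t - θ) := by fun_prop
    simpa using (this.tendsto 0).mono_left (nhdsWithin_le_nhds (s := Set.Ioi 0))
  have t2 : Filter.Tendsto (fun t : ℝ => -(θ + η * t)) (nhdsWithin 0 (Set.Ioi 0)) (nhds (-θ)) := by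
    have : Continuous (fun t : ℝ => -(θ + η * t)) := by fun_prop
    simpa using (this.tendsto 0).mono_left (nhdsWithin_le_nhds (s := Set.Ioi 0))
  have hb : Filter.Tendsto stdPhi Filter.atBot (nhds 0) := tendsto_cdf_atBot _
  have r1 := hb.comp (t1.neg_mul_atTop (by linarith) hs)
  have r2 := (hb.comp (t2.neg_mul_atTop (by linarith) hs)).const_mul (Real.exp (2 * η * θ))
  have r := r1.add r2
  rw [mul_zero, add_zero] at r
  exact r

lemma igF_tendsto_one (θ η : ℝ) (hη : 0 ≤ η) :
    Filter.Tendsto (igF θ η) Filter.atTop (nhds 1) := by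
  have hb : Filter.Tendsto stdPhi Filter.atBot (nhds 0) := tendsto_cdf_atBot _
  have ht : Filter.Tendsto stdPhi Filter.atTop (nhds 1) := tendsto_cdf_atTop _
  have hi : Filter.Tendsto (fun t => θ / Real.sqrt t) Filter.atTop (nhds 0) :=
    tendsto_const_nhds.div_atTop Real.tendsto_sqrt_atTop
  have q1 : (fun t => η * Real.sqrt t - θ / Real.sqrt t) =ᶠ[Filter.atTop]
      (fun t => (η * t - θ) / Real.sqrt t) := by
    filter_upwards [Filter.eventually_gt_atTop 0] with t h
    rw [sub_div, mul_div_assoc, Real.div_sqrt]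
  have q2 : (fun t => -(θ / Real.sqrt t) - η * Real.sqrt t) =ᶠ[Filter.atTop]
      (fun t => -(θ + η * t) / Real.sqrt t) := by
    filter_upwards [Filter.eventually_gt_atTop 0] with t h
    rw [neg_add, add_div, neg_div, neg_div, mul_div_assoc, Real.div_sqrt]
    ring
  rcases hη.eq_or_lt with h | h
  · subst h
    simp only [zero_mul, zero_sub, sub_zero] at q1 q2
    have r1 := (continuous_stdPhi.tendsto _).comp (hi.neg.congr' q1)
    have r2 := (continuous_stdPhi.tendsto _).comp (hi.neg.congr' q2)
    have := r1.add r2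
    have h0 := stdPhi_neg 0
    rw [neg_zero] at this h0
    rw [show stdPhi 0 + stdPhi 0 = 1 by linarith] at this
    refine this.congr fun t => ?_
    simp [igF]
  · have s1 : Filter.Tendsto (fun t => η * Real.sqrt t) Filter.atTop Filter.atTop :=
      Real.tendsto_sqrt_atTop.const_mul_atTop h
    have r1 := ht.comp (Filter.Tendsto.congr' q1
      (by simpa only [sub_eq_add_neg] using s1.atTop_add hi.neg))
    have s2 : Filter.Tendsto (fun t => -(η * Real.sqrt t)) Filter.atTop Filter.atBot :=
      Filter.tendsto_neg_atTop_atBot.comp s1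
    have s3 : Filter.Tendsto (fun t => -(θ / Real.sqrt t) - η * Real.sqrt t)
        Filter.atTop Filter.atBot := by
      simpa only [sub_eq_add_neg] using hi.neg.add_atBot s2
    have r2 := (hb.comp (Filter.Tendsto.congr' q2 s3)).const_mul (Real.exp (2 * η * θ))
    have r := r1.add r2
    rw [mul_zero, add_zero] at r
    exact r

/-- the inverse Gaussian density -/
lemma lintegral_igF (θ η : ℝ) (hθ : 0 < θ) (T : ℝ) (hT : 0 < T) :
    ∫⁻ t in Set.Iic T, ENNReal.ofReal
        (if 0 < t then
          θ / Real.sqrt (2 * Real.pi * t ^ 3) * Real.exp (-(θ - η * t) ^ 2 / (2 * t))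
        else 0) = ENNReal.ofReal (igF θ η T) := by
  set f : ℝ → ℝ := fun t => (if 0 < t then
          θ / Real.sqrt (2 * Real.pi * t ^ 3) * Real.exp (-(θ - η * t) ^ 2 / (2 * t))
        else 0) with hf
  have hfn : ∀ t, 0 ≤ f t := by
    intro t
    simp only [hf]
    split_ifs
    · positivity
    · exact le_rfl
  set F : ℝ → ℝ := fun t => if 0 < t then igF θ η t else 0 with hF
  have hFe : ∀ t, 0 < t → F =ᶠ[nhds t] igF θ η := by
    intro t ht
    filter_upwards [lt_mem_nhds ht] with s hs
    simp [hF, hs]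
  have hder : ∀ t, 0 < t → HasDerivAt F (f t) t := by
    intro t ht
    refine HasDerivAt.congr_of_eventuallyEq ?_ (hFe t ht)
    simpa [hf, ht] using igF_hasDerivAt θ η t ht
  have hcont : ContinuousOn F (Set.Icc 0 T) := by
    intro t ht
    rcases ht.1.eq_or_lt with h | h
    · subst h
      have : ContinuousWithinAt F (Set.Ioi 0) 0 := by
        have h0 : F 0 = 0 := by simp [hF]
        rw [ContinuousWithinAt, h0]
        refine (igF_tendsto_zero θ η hθ).congr' ?_
        filter_upwards [self_mem_nhdsWithin] with s hs
        have hs' : 0 < s := hs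
        simp [hF, hs']
      exact (continuousWithinAt_Ioi_iff_Ici.1 this).mono Set.Icc_subset_Ici_self
    · exact (hder t h).continuousAt.continuousWithinAt
  have hint : IntegrableOn f (Set.Ioc 0 T) :=
    intervalIntegral.integrableOn_deriv_of_nonneg hcont (fun t ht => hder t ht.1)
      (fun t _ => hfn t)
  have hI := intervalIntegral.integral_eq_sub_of_hasDerivAt_of_le hT.le hcont
    (fun t ht => hder t ht.1) ((intervalIntegrable_iff_integrableOn_Ioc_of_le hT.le).2 hint)
  rw [intervalIntegral.integral_of_le hT.le] at hI
  have hFT : F T - F 0 = igF θ η T := by simp [hF, hT]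
  rw [← hFT, ← hI, ofReal_integral_eq_lintegral_ofReal hint
    (Filter.Eventually.of_forall fun t => hfn t)]
  have hdis : Disjoint (Set.Iic (0:ℝ)) (Set.Ioc 0 T) :=
    Set.disjoint_left.2 fun x hx hx' => not_lt.2 hx hx'.1
  rw [← Set.Iic_union_Ioc_eq_Iic hT.le, lintegral_union measurableSet_Ioc
    hdis]
  have : ∫⁻ t in Set.Iic (0:ℝ), ENNReal.ofReal (f t) = 0 := by
    rw [setLIntegral_congr_fun (g := fun _ => 0) measurableSet_Iic]
    · simp
    · intro t ht
      have : ¬ (0 < t) := not_lt.2 ht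
      simp [hf, this]
  rw [this, zero_add]

/-- the past sigma-algebra -/
@[reducible]
def pastF {Ω : Type*} (B : ℝ → Ω → ℝ) (s : ℝ) : MeasurableSpace Ω :=
  ⨆ r ∈ Set.Icc (0 : ℝ) s, MeasurableSpace.comap (B r) inferInstance

/-- (a version of) the event that the process has hit zero by time `t` -/
def hitE {Ω : Type*} (B : ℝ → Ω → ℝ) (θ η t : ℝ) : Set Ω :=
  {ω | ∀ m : ℕ, ∃ q : ℚ, (q : ℝ) ∈ Set.Icc 0 t ∧ θ + B q ω - η * q < 1 / ((m : ℝ) + 1)}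

lemma hitE_mono {Ω : Type*} (B : ℝ → Ω → ℝ) (θ η : ℝ) {s t : ℝ} (h : s ≤ t) :
    hitE B θ η s ⊆ hitE B θ η t := by
  intro ω hω m
  obtain ⟨q, hq, hq'⟩ := hω m
  exact ⟨q, ⟨hq.1, hq.2.trans h⟩, hq'⟩

lemma measurable_pastF {Ω : Type*} (B : ℝ → Ω → ℝ) {r s : ℝ} (hr : r ∈ Set.Icc 0 s) :
    Measurable[pastF B s] (B r) := by
  refine Measurable.mono (comap_measurable (B r)) ?_ le_rfl
  exact le_iSup₂_of_le r hr le_rfl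

lemma measurableSet_hitE {Ω : Type*} (B : ℝ → Ω → ℝ) (θ η s : ℝ) :
    MeasurableSet[pastF B s] (hitE B θ η s) := by
  unfold hitE
  simp only [Set.ofPred_forall, Set.ofPred_exists]
  refine MeasurableSet.iInter fun m => MeasurableSet.iUnion fun q => ?_
  by_cases hq : (q : ℝ) ∈ Set.Icc 0 s
  · have h1 : Measurable[pastF B s] (fun ω => θ + B q ω - η * q) :=
      ((measurable_pastF B hq).const_add θ).sub_const _
    simp only [hq, true_and]
    exact h1 measurableSet_Iio
  · simp only [hq, false_and]
    exact @MeasurableSet.empty _ (pastF B s)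

lemma pastF_le {Ω : Type*} [mΩ : MeasurableSpace Ω] (B : ℝ → Ω → ℝ) (hm : ∀ t, Measurable (B t))
    (s : ℝ) : pastF B s ≤ mΩ :=
  iSup₂_le fun r _ => (hm r).comap_le

lemma step_identity {Ω : Type*} [MeasurableSpace Ω]
    (P : Measure Ω) (B : ℝ → Ω → ℝ) (hB : IsStdBrownianMotion P B)
    (θ η : ℝ) (hη : 0 ≤ η) (s T : ℝ) (hs : 0 ≤ s) (hsT : s ≤ T) (A : Set Ω)
    (hA : MeasurableSet[pastF B s] A) :
    ∫ ω, A.indicator (fun _ => (1:ℝ)) ω * gfun η (θ + B T ω - η * T) ∂P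
      = ∫ ω, A.indicator (fun _ => (1:ℝ)) ω * Gfun η (θ + B s ω - η * s) (T - s) ∂P := by
  have := hB.isProbability
  have hle := pastF_le B hB.measurable s
  set Z : Ω → ℝ × ℝ := fun ω => (A.indicator (fun _ => (1:ℝ)) ω, θ + B s ω - η * s) with hZ
  set Y : Ω → ℝ := fun ω => B T ω - B s ω with hY
  have hZm' : Measurable[pastF B s] Z :=
    (Measurable.indicator measurable_const hA).prodMk
      (((measurable_pastF B (Set.right_mem_Icc.2 hs)).const_add θ).sub_const _)
  have hZm : Measurable Z := hZm'.mono hle le_rfl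
  have hYm : Measurable Y := (hB.measurable T).sub (hB.measurable s)
  have hind : IndepFun Z Y P := by
    rw [IndepFun_iff_Indep]
    exact (indep_of_indep_of_le_right (hB.incr_indep s T hs hsT) hZm'.comap_le).symm
  have hlaw := (indepFun_iff_map_prod_eq_prod_map_map hZm.aemeasurable hYm.aemeasurable).1 hind
  rw [hB.incr_law s T hs hsT] at hlaw
  set φ : (ℝ × ℝ) × ℝ → ℝ := fun p => p.1.1 * gfun η (p.1.2 + p.2 - η * (T - s)) with hφ
  have hφm : Measurable φ := by
    have := measurable_gfun η
    fun_prop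
  have hbd : ∀ ω, |A.indicator (fun _ => (1:ℝ)) ω| ≤ 1 := by
    intro ω
    by_cases h : ω ∈ A <;> simp [h]
  have e1 : ∫ ω, A.indicator (fun _ => (1:ℝ)) ω * gfun η (θ + B T ω - η * T) ∂P
      = ∫ ω, φ (Z ω, Y ω) ∂P := by
    congr 1
    funext ω
    simp only [hφ, hZ, hY]
    congr 2
    ring
  have hint : Integrable φ (Measure.map (fun ω => (Z ω, Y ω)) P) := by
    rw [integrable_map_measure hφm.aestronglyMeasurable (hZm.prodMk hYm).aemeasurable]
    refine Integrable.of_bound (C := 1) ?_ (Filter.Eventually.of_forall fun ω => ?_)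
    · exact (hφm.comp (hZm.prodMk hYm)).aestronglyMeasurable
    · simp only [Function.comp, hφ, hZ, Real.norm_eq_abs, abs_mul]
      exact mul_le_one₀ (hbd ω) (abs_nonneg _) (abs_gfun_le η hη _)
  rw [e1, ← integral_map (f := φ) (hZm.prodMk hYm).aemeasurable hφm.aestronglyMeasurable]
  rw [hlaw] at hint ⊢
  rw [integral_prod _ hint, integral_map hZm.aemeasurable]
  · congr 1
    funext ω
    simp only [hφ, hZ, Gfun]
    rw [integral_const_mul]
  · exact (hφm.stronglyMeasurable.integral_prod_right').aestronglyMeasurable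

lemma hitE_iff {Ω : Type*} (B : ℝ → Ω → ℝ) (θ η : ℝ) (hθ : 0 < θ) (ω : Ω)
    (hc : ContinuousOn (fun t => B t ω) (Set.Ici 0)) (h0 : B 0 ω = 0) (t : ℝ) (ht : 0 ≤ t) :
    ω ∈ hitE B θ η t ↔ ∃ s ∈ Set.Icc 0 t, θ + B s ω - η * s = 0 := by
  have hX : ContinuousOn (fun t => θ + B t ω - η * t) (Set.Ici 0) :=
    (continuousOn_const.add hc).sub (by fun_prop)
  have hXt : ContinuousOn (fun t => θ + B t ω - η * t) (Set.Icc 0 t) :=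
    hX.mono Set.Icc_subset_Ici_self
  constructor
  · intro h
    obtain ⟨x, hx, hmin⟩ := isCompact_Icc.exists_isMinOn (Set.nonempty_Icc.2 ht) hXt
    have hx0 : θ + B x ω - η * x ≤ 0 := by
      by_contra! hpos
      obtain ⟨m, hm⟩ := exists_nat_one_div_lt hpos
      obtain ⟨q, hq, hq'⟩ := h m
      have := hmin hq
      simp only [Set.mem_ofPred_eq] at this
      linarith
    have hivt := intermediate_value_Icc' hx.1 (hX.mono Set.Icc_subset_Ici_self)
    obtain ⟨s, hs, hs'⟩ := hivt (show (0:ℝ) ∈ _ from ⟨hx0, by simp [h0, hθ.le]⟩)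
    exact ⟨s, ⟨hs.1, hs.2.trans hx.2⟩, hs'⟩
  · rintro ⟨s, hs, hs0⟩ m
    have htpos : 0 < t := by
      rcases ht.eq_or_lt with h | h
      · subst h
        have : s = 0 := le_antisymm hs.2 hs.1
        subst this
        simp [h0] at hs0
        linarith
      · exact h
    have hcl : s ∈ closure (Set.Icc 0 t ∩ Set.range ((↑) : ℚ → ℝ)) := by
      rw [closure_ordConnected_inter_rat Set.ordConnected_Icc
        ⟨0, Set.left_mem_Icc.2 ht, t, Set.right_mem_Icc.2 ht, htpos.ne⟩]
      exact subset_closure hs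
    have hev : ∀ᶠ u in nhdsWithin s (Set.Icc 0 t), θ + B u ω - η * u < 1 / ((m : ℝ) + 1) := by
      refine (hXt s hs).eventually (gt_mem_nhds ?_)
      simp only [hs0]
      positivity
    rw [mem_closure_iff_frequently] at hcl
    rw [eventually_nhdsWithin_iff] at hev
    obtain ⟨u, ⟨hu1, q, rfl⟩, hu2⟩ := (hcl.and_eventually hev).exists
    exact ⟨q, hu1, hu2 hu1⟩

/-- On good paths, membership in `hitE` in terms of the hitting time. -/
lemma hitE_iff_sInf {Ω : Type*} (B : ℝ → Ω → ℝ) (θ η : ℝ) (hθ : 0 < θ) (ω : Ω)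
    (hc : ContinuousOn (fun t => B t ω) (Set.Ici 0)) (h0 : B 0 ω = 0)
    (hne : {t : ℝ | 0 ≤ t ∧ θ + B t ω - η * t = 0}.Nonempty) :
    0 < sInf {t : ℝ | 0 ≤ t ∧ θ + B t ω - η * t = 0} ∧
    θ + B (sInf {t : ℝ | 0 ≤ t ∧ θ + B t ω - η * t = 0}) ω
      - η * sInf {t : ℝ | 0 ≤ t ∧ θ + B t ω - η * t = 0} = 0 ∧
    ∀ t, 0 ≤ t → (ω ∈ hitE B θ η t ↔ sInf {t : ℝ | 0 ≤ t ∧ θ + B t ω - η * t = 0} ≤ t) := by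
  have hX : ContinuousOn (fun t => θ + B t ω - η * t) (Set.Ici 0) :=
    (continuousOn_const.add hc).sub (by fun_prop)
  set S := {t : ℝ | 0 ≤ t ∧ θ + B t ω - η * t = 0} with hS
  have hcl : IsClosed S := by
    have := hX.preimage_isClosed_of_isClosed isClosed_Ici (isClosed_singleton (x := (0:ℝ)))
    exact this
  have hbb : BddBelow S := ⟨0, fun x hx => hx.1⟩
  have hmem : sInf S ∈ S := hcl.csInf_mem hne hbb
  refine ⟨?_, hmem.2, ?_⟩
  · refine lt_of_le_of_ne hmem.1 fun h => ?_
    have := hmem.2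
    rw [← h, h0] at this
    linarith
  · intro t ht
    rw [hitE_iff B θ η hθ ω hc h0 t ht]
    constructor
    · rintro ⟨s, hs, hs'⟩
      exact (csInf_le hbb ⟨hs.1, hs'⟩).trans hs.2
    · intro h
      exact ⟨sInf S, ⟨hmem.1, h⟩, hmem.2⟩

lemma ae_ne_zero {Ω : Type*} [MeasurableSpace Ω]
    (P : Measure Ω) (B : ℝ → Ω → ℝ) (hB : IsStdBrownianMotion P B)
    (θ η : ℝ) (T : ℝ) (hT : 0 < T) : ∀ᵐ ω ∂P, θ + B T ω - η * T ≠ 0 := by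
  have hl := hB.incr_law 0 T le_rfl hT.le
  have hv : (T - 0).toNNReal ≠ 0 := by simpa using hT
  have := nullSingletonClass_gaussianReal (μ := 0) (v := (T - 0).toNNReal) hv
  have h1 : (Measure.map (fun ω => B T ω - B 0 ω) P) {η * T - θ} = 0 := by
    rw [hl]
    exact measure_singleton _
  have hmm : Measurable (fun ω => B T ω - B 0 ω) := (hB.measurable T).sub (hB.measurable 0)
  rw [Measure.map_apply hmm (measurableSet_singleton _)] at h1
  filter_upwards [measure_eq_zero_iff_ae_notMem.1 h1, hB.init] with ω h2 h3 h4
  apply h2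
  simp only [Set.mem_preimage, Set.mem_singleton_iff, h3]
  linarith

lemma reflection {Ω : Type*} [MeasurableSpace Ω]
    (P : Measure Ω) (B : ℝ → Ω → ℝ) (hB : IsStdBrownianMotion P B)
    (θ η : ℝ) (hθ : 0 < θ) (hη : 0 ≤ η) (T : ℝ) (hT : 0 < T) :
    ∫ ω, (hitE B θ η T).indicator (fun _ => (1:ℝ)) ω * gfun η (θ + B T ω - η * T) ∂P = 0 := by
  have := hB.isProbability
  set I : ℝ → Ω → ℝ := fun t => (hitE B θ η t).indicator (fun _ => (1:ℝ)) with hI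
  have hmeasE : ∀ t, MeasurableSet (hitE B θ η t) := fun t =>
    pastF_le B hB.measurable t _ (measurableSet_hitE B θ η t)
  have hIm : ∀ t, Measurable (I t) := fun t => measurable_const.indicator (hmeasE t)
  have hI0 : ∀ t ω, 0 ≤ I t ω := fun t ω => Set.indicator_nonneg (fun _ _ => zero_le_one) _
  have hI1 : ∀ t ω, I t ω ≤ 1 := fun t ω => Set.indicator_le_self' (fun _ _ => zero_le_one) _
  have hImono : ∀ s t ω, s ≤ t → I s ω ≤ I t ω := fun s t ω h =>
    Set.indicator_le_indicator_of_subset (hitE_mono B θ η h) (fun _ => zero_le_one) _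
  have hGm : ∀ h, Measurable (fun x => Gfun η x h) := by
    intro h
    have : StronglyMeasurable (fun p : ℝ × ℝ => gfun η (p.1 + p.2 - η * h)) := by
      have := measurable_gfun η
      exact Measurable.stronglyMeasurable (by fun_prop)
    exact (this.integral_prod_right' (ν := gaussianReal 0 h.toNNReal)).measurable
  -- grid
  set g : ℕ → ℕ → ℝ := fun n k => T * (k / ((n:ℝ) + 1)) with hg
  have hg0 : ∀ n, g n 0 = 0 := fun n => by simp [hg]
  have hgn : ∀ n, g n (n + 1) = T := fun n => by
    have : (n:ℝ) + 1 ≠ 0 := by positivity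
    simp [hg, this]
  have hgs : ∀ n k, g n (k + 1) = g n k + T / (n + 1) := fun n k => by
    simp only [hg]
    push_cast
    field_simp
  have hgpos : ∀ n k, 0 ≤ g n k := fun n k => by positivity
  have hgle : ∀ n k, g n k ≤ g n (k + 1) := fun n k => by
    rw [hgs]
    have : 0 ≤ T / ((n:ℝ) + 1) := by positivity
    linarith
  have hgT : ∀ n k, k ≤ n + 1 → g n k ≤ T := fun n k h => by
    rw [← hgn n]
    simp only [hg]
    gcongr
  set H : ℕ → Ω → ℝ := fun n ω => ∑ k ∈ Finset.range (n + 1),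
    (I (g n (k + 1)) ω - I (g n k) ω)
      * Gfun η (θ + B (g n (k + 1)) ω - η * g n (k + 1)) (T - g n (k + 1)) with hH
  have hHm : ∀ n, Measurable (H n) := fun n => by
    refine Finset.measurable_sum _ fun k _ => ?_
    refine ((hIm _).sub (hIm _)).mul ?_
    exact (hGm _).comp (((hB.measurable _).const_add θ).sub_const _)
  have hHbd : ∀ n ω c, (∀ k, k < n + 1 → 0 < I (g n (k + 1)) ω - I (g n k) ω →
      |Gfun η (θ + B (g n (k + 1)) ω - η * g n (k + 1)) (T - g n (k + 1))| ≤ c) → 0 ≤ c →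
      |H n ω| ≤ c := by
    intro n ω c hk hc
    calc |H n ω| ≤ ∑ k ∈ Finset.range (n + 1), (I (g n (k + 1)) ω - I (g n k) ω) * c := by
          refine (Finset.abs_sum_le_sum_abs _ _).trans (Finset.sum_le_sum fun k hkr => ?_)
          have hd : 0 ≤ I (g n (k + 1)) ω - I (g n k) ω := sub_nonneg.2 (hImono _ _ _ (hgle n k))
          rw [abs_mul, abs_of_nonneg hd]
          rcases hd.eq_or_lt with h | h
          · rw [← h]; simp
          · exact mul_le_mul_of_nonneg_left (hk k (Finset.mem_range.1 hkr) h) hd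
      _ = (I (g n (n + 1)) ω - I (g n 0) ω) * c := by
          rw [← Finset.sum_mul, Finset.sum_range_sub (fun k => I (g n k) ω)]
      _ ≤ 1 * c := by
          refine mul_le_mul_of_nonneg_right ?_ hc
          have := hI0 (g n 0) ω
          have := hI1 (g n (n + 1)) ω
          linarith
      _ = c := one_mul c
  have hXm : Measurable (fun ω => gfun η (θ + B T ω - η * T)) :=
    (measurable_gfun η).comp (((hB.measurable _).const_add θ).sub_const _)
  have hintI : ∀ t, Integrable (fun ω => I t ω * gfun η (θ + B T ω - η * T)) P := by
    intro t
    refine Integrable.of_bound (C := 1) ((hIm t).mul hXm).aestronglyMeasurable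
      (Filter.Eventually.of_forall fun ω => ?_)
    rw [Real.norm_eq_abs, abs_mul, abs_of_nonneg (hI0 t ω)]
    exact mul_le_one₀ (hI1 t ω) (abs_nonneg _) (abs_gfun_le η hη _)
  have hintG : ∀ t s h, Integrable (fun ω => I t ω * Gfun η (θ + B s ω - η * s) h) P := by
    intro t s h
    refine Integrable.of_bound (C := 1) ((hIm t).mul ((hGm h).comp
      (((hB.measurable _).const_add θ).sub_const _))).aestronglyMeasurable
      (Filter.Eventually.of_forall fun ω => ?_)
    rw [Real.norm_eq_abs, abs_mul, abs_of_nonneg (hI0 t ω)]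
    exact mul_le_one₀ (hI1 t ω) (abs_nonneg _) (abs_Gfun_le η hη _ _)
  have hnull : ∀ᵐ ω ∂P, I 0 ω = 0 := by
    filter_upwards [hB.cont, hB.init] with ω hc h0
    have : ω ∉ hitE B θ η 0 := by
      rw [hitE_iff B θ η hθ ω hc h0 0 le_rfl]
      rintro ⟨s, hs, hs'⟩
      have : s = 0 := le_antisymm hs.2 hs.1
      subst this
      simp [h0] at hs'
      linarith
    simp [hI, this]
  have hHint : ∀ n, ∫ ω, H n ω ∂P = ∫ ω, I T ω * gfun η (θ + B T ω - η * T) ∂P := by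
    intro n
    have hk : ∀ k ∈ Finset.range (n + 1), ∫ ω, (I (g n (k + 1)) ω - I (g n k) ω)
        * Gfun η (θ + B (g n (k + 1)) ω - η * g n (k + 1)) (T - g n (k + 1)) ∂P
        = ∫ ω, I (g n (k + 1)) ω * gfun η (θ + B T ω - η * T) ∂P
          - ∫ ω, I (g n k) ω * gfun η (θ + B T ω - η * T) ∂P := by
      intro k hkr
      have hkn : k + 1 ≤ n + 1 := Finset.mem_range.1 hkr
      have hmono : pastF B (g n k) ≤ pastF B (g n (k + 1)) :=
        biSup_mono fun r hr => ⟨hr.1, hr.2.trans (hgle n k)⟩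
      have a1 := step_identity P B hB θ η hη (g n (k + 1)) T (hgpos _ _) (hgT n _ hkn)
        (hitE B θ η (g n (k + 1))) (measurableSet_hitE B θ η _)
      have a2 := step_identity P B hB θ η hη (g n (k + 1)) T (hgpos _ _) (hgT n _ hkn)
        (hitE B θ η (g n k)) (hmono _ (measurableSet_hitE B θ η _))
      simp only [hI]
      rw [a1, a2, ← integral_sub (hintG _ _ _) (hintG _ _ _)]
      simp only [sub_mul]
      rfl
    simp only [hH]
    rw [integral_finsetSum, Finset.sum_congr rfl hk,
      Finset.sum_range_sub (fun k => ∫ ω, I (g n k) ω * gfun η (θ + B T ω - η * T) ∂P), hgn, hg0]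
    · have : ∫ ω, I 0 ω * gfun η (θ + B T ω - η * T) ∂P = 0 := by
        rw [integral_eq_zero_of_ae]
        filter_upwards [hnull] with ω h
        simp [h]
      rw [this, sub_zero]
    · intro k _
      simp only [sub_mul]
      exact (hintG _ _ _).sub (hintG _ _ _)
  have hlim : Filter.Tendsto (fun n => ∫ ω, H n ω ∂P) Filter.atTop (nhds (∫ ω, (0:ℝ) ∂P)) := by
    refine tendsto_integral_of_dominated_convergence (fun _ => 1)
      (fun n => (hHm n).aestronglyMeasurable) (integrable_const _) (fun n => ?_) ?_
    · exact Filter.Eventually.of_forall fun ω =>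
        hHbd n ω 1 (fun k _ _ => abs_Gfun_le η hη _ _) zero_le_one
    · filter_upwards [hB.cont, hB.init, ae_ne_zero P B hB θ η T hT] with ω hc h0 hne
      by_cases hT' : ω ∈ hitE B θ η T
      · have hex := (hitE_iff B θ η hθ ω hc h0 T hT.le).1 hT'
        have hSne : {t : ℝ | 0 ≤ t ∧ θ + B t ω - η * t = 0}.Nonempty := by
          obtain ⟨s, hs, hs'⟩ := hex
          exact ⟨s, hs.1, hs'⟩
        obtain ⟨hτ0, hτX, hτ⟩ := hitE_iff_sInf B θ η hθ ω hc h0 hSne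
        set τ := sInf {t : ℝ | 0 ≤ t ∧ θ + B t ω - η * t = 0} with hτdef
        have hτT : τ < T := by
          refine lt_of_le_of_ne ((hτ T hT.le).1 hT') fun h => hne ?_
          rw [← h]
          exact hτX
        have hXc : ContinuousAt (fun t => θ + B t ω - η * t) τ :=
          ((continuousAt_const.add (hc.continuousAt (Ici_mem_nhds hτ0))).sub (by fun_prop))
        have hGt : Filter.Tendsto (fun s => Gfun η (θ + B s ω - η * s) (T - s)) (nhds τ)
            (nhds 0) := by
          refine Gfun_tendsto η hη _ _ _ (T - τ) (by linarith) ?_ ?_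
          · have := hXc.tendsto
            rwa [hτX] at this
          · exact (continuous_const.sub continuous_id).tendsto τ
        rw [Metric.tendsto_atTop]
        intro ε hε
        obtain ⟨δ, hδ, hδ'⟩ := Metric.tendsto_nhds_nhds.1 hGt (ε / 2) (half_pos hε)
        obtain ⟨N, hN⟩ := exists_nat_one_div_lt (div_pos hδ hT)
        refine ⟨N, fun n hn => ?_⟩
        rw [Real.dist_eq, sub_zero]
        refine lt_of_le_of_lt (hHbd n ω (ε / 2) (fun k hk hd => ?_) (half_pos hε).le)
          (half_lt_self hε)
        have m1 : ω ∈ hitE B θ η (g n (k + 1)) := by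
          by_contra hcon
          have e1 : I (g n (k + 1)) ω = 0 := by simp [hI, hcon]
          have := hI0 (g n k) ω
          linarith
        have m2 : ω ∉ hitE B θ η (g n k) := by
          intro hcon
          have e1 : I (g n k) ω = 1 := by simp [hI, hcon]
          have := hI1 (g n (k + 1)) ω
          linarith
        rw [hτ _ (hgpos _ _)] at m1 m2
        have hst := hgs n k
        have hsm : T / ((n:ℝ) + 1) < δ := by
          have h1 : 1 / ((n:ℝ) + 1) ≤ 1 / ((N:ℝ) + 1) := by
            apply one_div_le_one_div_of_le (by positivity)
            have : (N:ℝ) ≤ n := by exact_mod_cast hn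
            linarith
          have h2 := h1.trans_lt hN
          rw [lt_div_iff₀ hT] at h2
          calc T / ((n:ℝ) + 1) = 1 / ((n:ℝ) + 1) * T := by ring
            _ < δ := h2
        have := hδ' (x := g n (k + 1)) (by
          rw [Real.dist_eq, abs_of_nonneg (by linarith)]
          linarith [not_le.1 m2])
        rw [Real.dist_eq, sub_zero] at this
        exact this.le
      · have : ∀ n, H n ω = 0 := by
          intro n
          have := hHbd n ω 0 (fun k hk hd => ?_) le_rfl
          · exact abs_eq_zero.1 (le_antisymm this (abs_nonneg _))
          · exfalso
            have e0 : I T ω = 0 := by simp [hI, hT']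
            have := hImono _ _ ω (hgT n (k + 1) hk)
            have := hI0 (g n k) ω
            linarith
        simp [this]
  simp only [hHint, integral_zero] at hlim
  exact tendsto_nhds_unique tendsto_const_nhds hlim

lemma prob_hitE {Ω : Type*} [MeasurableSpace Ω]
    (P : Measure Ω) (B : ℝ → Ω → ℝ) (hB : IsStdBrownianMotion P B)
    (θ η : ℝ) (hθ : 0 < θ) (hη : 0 ≤ η) (T : ℝ) (hT : 0 < T) :
    P.real (hitE B θ η T) = igF θ η T := by
  have := hB.isProbability
  have hmE : MeasurableSet (hitE B θ η T) :=
    pastF_le B hB.measurable T _ (measurableSet_hitE B θ η T)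
  have h1 := reflection P B hB θ η hθ hη T hT
  have h2 := step_identity P B hB θ η hη 0 T le_rfl hT.le Set.univ
    (@MeasurableSet.univ _ (pastF B 0))
  have h3 : ∫ ω, Set.univ.indicator (fun _ => (1:ℝ)) ω * Gfun η (θ + B 0 ω - η * 0) (T - 0) ∂P
      = Gfun η θ T := by
    rw [integral_congr_ae (g := fun _ => Gfun η θ T)]
    · simp
    · filter_upwards [hB.init] with ω h
      simp [h]
  rw [h3] at h2
  have hXm : Measurable (fun ω => gfun η (θ + B T ω - η * T)) :=
    (measurable_gfun η).comp (((hB.measurable _).const_add θ).sub_const _)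
  have hint : ∀ A : Set Ω, MeasurableSet A →
      Integrable (fun ω => A.indicator (fun _ => (1:ℝ)) ω * gfun η (θ + B T ω - η * T)) P := by
    intro A hA
    refine Integrable.of_bound (C := 1)
      ((measurable_const.indicator hA).mul hXm).aestronglyMeasurable
      (Filter.Eventually.of_forall fun ω => ?_)
    by_cases h : ω ∈ A
    · simpa [h] using abs_gfun_le η hη _
    · simp [h]
  have h4 : P.real (hitE B θ η T)ᶜ = Gfun η θ T := by
    rw [← h2, ← sub_zero (∫ ω, _ ∂P), ← h1, ← integral_sub (hint _ MeasurableSet.univ)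
      (hint _ hmE), ← integral_indicator_one hmE.compl]
    refine integral_congr_ae ?_
    filter_upwards [hB.cont, hB.init] with ω hc h0
    by_cases h : ω ∈ hitE B θ η T
    · simp [h]
    · have hpos : 0 < θ + B T ω - η * T := by
        by_contra! hcon
        apply h
        rw [hitE_iff B θ η hθ ω hc h0 T hT.le]
        have hX : ContinuousOn (fun t => θ + B t ω - η * t) (Set.Icc 0 T) :=
          ((continuousOn_const.add hc).sub (by fun_prop)).mono Set.Icc_subset_Ici_self
        obtain ⟨s, hs, hs'⟩ := intermediate_value_Icc' hT.le hX
          (show (0:ℝ) ∈ _ from ⟨hcon, by simp [h0, hθ.le]⟩)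
        exact ⟨s, hs, hs'⟩
      simp [h, gfun, Set.indicator, hpos, not_lt.2 hpos.le]
  rw [igF_eq θ η hη T hT, ← h4, probReal_compl_eq_one_sub hmE]
  ring

/-- The first hitting time of `0` by `θ + B_t − η t` is a.s. finite and has the
Inverse Gaussian distribution `IG(θ/η, θ²)`. -/
theorem hittingTime_law_inverseGaussian {Ω : Type*} [MeasurableSpace Ω]
    (P : Measure Ω) (B : ℝ → Ω → ℝ) (hB : IsStdBrownianMotion P B)
    (θ η : ℝ) (hθ : 0 < θ) (hη : 0 ≤ η) :
    (∀ᵐ ω ∂P, {t : ℝ | 0 ≤ t ∧ θ + B t ω - η * t = 0}.Nonempty) ∧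
    Measure.map (fun ω => sInf {t : ℝ | 0 ≤ t ∧ θ + B t ω - η * t = 0}) P =
      volume.withDensity (fun t : ℝ => ENNReal.ofReal
        (if 0 < t then
          θ / Real.sqrt (2 * Real.pi * t ^ 3) * Real.exp (-(θ - η * t) ^ 2 / (2 * t))
        else 0)) := by
  have := hB.isProbability
  have hmE : ∀ t, MeasurableSet (hitE B θ η t) := fun t =>
    pastF_le B hB.measurable t _ (measurableSet_hitE B θ η t)
  have hne : ∀ᵐ ω ∂P, {t : ℝ | 0 ≤ t ∧ θ + B t ω - η * t = 0}.Nonempty := by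
    have hz : P (⋂ n : ℕ, (hitE B θ η ((n:ℝ) + 1))ᶜ) = 0 := by
      have hle : ∀ n : ℕ, P.real (⋂ n : ℕ, (hitE B θ η ((n:ℝ) + 1))ᶜ)
          ≤ 1 - igF θ η ((n:ℝ) + 1) := by
        intro n
        rw [← prob_hitE P B hB θ η hθ hη _ (by positivity),
          ← probReal_compl_eq_one_sub (hmE _)]
        exact measureReal_mono (Set.iInter_subset _ n)
      have hl : Filter.Tendsto (fun n : ℕ => 1 - igF θ η ((n:ℝ) + 1)) Filter.atTop
          (nhds (1 - 1)) :=
        ((igF_tendsto_one θ η hη).comp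
          (Filter.tendsto_atTop_add_const_right _ 1 tendsto_natCast_atTop_atTop)).const_sub 1
      rw [sub_self] at hl
      have h0 := ge_of_tendsto' hl hle
      exact (measureReal_eq_zero_iff).1 (le_antisymm h0 measureReal_nonneg)
    filter_upwards [hB.cont, hB.init, measure_eq_zero_iff_ae_notMem.1 hz] with ω hc h0 h
    simp only [Set.mem_iInter, Set.mem_compl_iff, not_forall, not_not] at h
    obtain ⟨n, hn⟩ := h
    obtain ⟨s, hs, hs'⟩ := (hitE_iff B θ η hθ ω hc h0 _ (by positivity)).1 hn
    exact ⟨s, hs.1, hs'⟩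
  refine ⟨hne, ?_⟩
  set τ : Ω → ℝ := fun ω => sInf {t : ℝ | 0 ≤ t ∧ θ + B t ω - η * t = 0} with hτ
  have hpos : ∀ t, 0 < t → τ ⁻¹' (Set.Iic t) =ᵐ[P] hitE B θ η t := by
    intro t ht
    rw [Filter.eventuallyEq_set]
    filter_upwards [hB.cont, hB.init, hne] with ω hc h0 h
    exact ((hitE_iff_sInf B θ η hθ ω hc h0 h).2.2 t ht.le).symm
  have hneg : ∀ t, t ≤ 0 → τ ⁻¹' (Set.Iic t) =ᵐ[P] (∅ : Set Ω) := by
    intro t ht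
    rw [Filter.eventuallyEq_set]
    filter_upwards [hB.cont, hB.init, hne] with ω hc h0 h
    have := (hitE_iff_sInf B θ η hθ ω hc h0 h).1
    simp only [Set.mem_preimage, Set.mem_Iic, Set.mem_empty_iff_false, iff_false, not_le, hτ]
    linarith
  have hnm : NullMeasurable τ P := by
    have : @Measurable (NullMeasurableSpace Ω P) ℝ _ _ τ := by
      refine measurable_of_Iic fun t => ?_
      change NullMeasurableSet (τ ⁻¹' (Set.Iic t)) P
      rcases le_or_gt t 0 with h | h
      · exact (MeasurableSet.empty.nullMeasurableSet).congr (hneg t h).symm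
      · exact ((hmE t).nullMeasurableSet).congr (hpos t h).symm
    exact fun s hs => this hs
  have hae : AEMeasurable τ P := hnm.aemeasurable
  have : IsProbabilityMeasure (Measure.map τ P) := Measure.isProbabilityMeasure_map hae
  refine Measure.ext_of_Iic _ _ fun t => ?_
  rw [Measure.map_apply_of_aemeasurable hae measurableSet_Iic,
    withDensity_apply _ measurableSet_Iic]
  rcases le_or_gt t 0 with h | h
  · rw [measure_congr (hneg t h), measure_empty, setLIntegral_congr_fun (g := fun _ => 0)
      measurableSet_Iic]
    · simp
    · intro s hs
      have : ¬ (0 < s) := not_lt.2 (le_trans hs h)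
      simp [this]
  · rw [measure_congr (hpos t h), lintegral_igF θ η hθ t h,
      ← prob_hitE P B hB θ η hθ hη t h, ofReal_measureReal]
end
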